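/- arXiv:2102.05777 — 3 statements merged into one kernel-verified Lean document; each statement's English description precedes it below -/
import Mathlib

section
/- There exists a universal constant C_w such that for every finite set E ⊂ ℝ² there is a map T_w : W²₊(E) → C²₊(ℝ²) with the following properties: for every P⃗ = (P^x)_{x∈E} ∈ W²₊(E), the function T_w(P⃗) is nonnegative on ℝ², ‖T_w(P⃗)‖_{C²(ℝ²)} ≤ C_w·‖P⃗‖_{W²₊(E)}, and J_x T_w(P⃗) = P^x for each x ∈ E. -/
/-- The plane `ℝ²`. -/
abbrev E2 := EuclideanSpace ℝ (Fin 2)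

open scoped Classical

/-- An affine polynomial on `ℝ²`, represented by its constant term and linear
part: `P(y) = P.1 + P.2 y`. -/
abbrev AffPoly := ℝ × (E2 →L[ℝ] ℝ)

/-- Evaluation of an affine polynomial. -/
def evalA (P : AffPoly) (y : E2) : ℝ := P.1 + P.2 y

/-- The Whitney norm `‖P⃗‖_{W²(S)}`. -/
noncomputable def wNorm (S : Finset E2) (P : E2 → AffPoly) : ℝ :=
  (⨆ x ∈ (S : Set E2), max |evalA (P x) x| ‖(P x).2‖) +
  (⨆ x ∈ (S : Set E2), ⨆ y ∈ (S : Set E2), if x = y then 0 else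
    max (|evalA (P x) x - evalA (P y) x| / dist x y ^ 2)
        (‖(P x).2 - (P y).2‖ / dist x y))

/-- Membership in `W²₊(S)`. -/
def wPlusMem (S : Finset E2) (P : E2 → AffPoly) : Prop :=
  ∀ x ∈ S, ∃ M : ℝ, 0 ≤ M ∧ ∀ y : E2, 0 ≤ evalA (P x) y + M * dist y x ^ 2

/-- The norm `‖P⃗‖_{W²₊(S)}`. -/
noncomputable def wPlusNorm (S : Finset E2) (P : E2 → AffPoly) : ℝ :=
  wNorm S P + ⨆ x ∈ (S : Set E2),
    sInf {M : ℝ | 0 ≤ M ∧ ∀ y : E2, 0 ≤ evalA (P x) y + M * dist y x ^ 2}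

section
variable {V : Type*} [NormedAddCommGroup V] [NormedSpace ℝ V]

theorem ContinuousLinearMap.norm_le_of_sphere (L : V →L[ℝ] ℝ) {ρ K : ℝ} (hρ : 0 < ρ)
    (hK : 0 ≤ K) (h : ∀ v, ‖v‖ = ρ → |L v| ≤ K * ρ) : ‖L‖ ≤ K := by
  refine L.opNorm_le_of_unit_norm hK fun v hv => ?_
  have h1 := h (ρ • v) (by rw [norm_smul, hv, Real.norm_of_nonneg hρ.le, mul_one])
  rw [map_smul, smul_eq_mul, abs_mul, abs_of_pos hρ, mul_comm] at h1
  exact le_of_mul_le_mul_right h1 hρ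

/-- The second differences of `u` are at most those of `(M / 2) ‖·‖²`. -/
def SecondDifferenceBound (M : ℝ) (u : V → ℝ) : Prop :=
  ∀ x h, |u (x + h) + u (x - h) - 2 * u x| ≤ M * ‖h‖ ^ 2

theorem SecondDifferenceBound.abs_taylor_le {M : ℝ} {u : V → ℝ}
    (hu : SecondDifferenceBound M u) (hd : Differentiable ℝ u) (x h : V) :
    |u (x + h) - u x - fderiv ℝ u x h| ≤ M / 2 * ‖h‖ ^ 2 := by
  have key : ∀ n : ℕ, |u (x + h) - u x - 2 ^ n * (u (x + ((2 : ℝ) ^ n)⁻¹ • h) - u x)|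
      ≤ M / 2 * ‖h‖ ^ 2 * (1 - ((2 : ℝ) ^ n)⁻¹) := by
    intro n
    induction n with
    | zero => simp
    | succ n ih =>
      set c : ℝ := ((2 : ℝ) ^ (n + 1))⁻¹ with hc
      have hc0 : 0 < c := by positivity
      have hpn : (2 : ℝ) ^ n * (2 * c) = 1 := by rw [hc, pow_succ]; field_simp
      have hcn : ((2 : ℝ) ^ n)⁻¹ = 2 * c := by rw [hc, pow_succ]; field_simp
      have h1 := hu (x + c • h) (c • h)
      have e1 : x + c • h + c • h = x + (2 * c) • h := by module
      have e2 : x + c • h - c • h = x := by abel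
      rw [e1, e2, norm_smul, Real.norm_of_nonneg hc0.le] at h1
      rw [hcn] at ih
      have hp : (0 : ℝ) < 2 ^ n := by positivity
      have h2 := mul_le_mul_of_nonneg_left h1 hp.le
      rw [← abs_of_pos hp, ← abs_mul, abs_of_pos hp] at h2
      have e3 : (2 : ℝ) ^ n * (M * (c * ‖h‖) ^ 2) = M / 2 * ‖h‖ ^ 2 * c := by
        linear_combination M / 2 * ‖h‖ ^ 2 * c * hpn
      rw [e3] at h2
      rw [pow_succ, abs_le] at *
      constructor <;> linarith [h2.1, h2.2, ih.1, ih.2]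
  have ht : Filter.Tendsto (fun n : ℕ => (2 : ℝ) ^ n) Filter.atTop Filter.atTop :=
    tendsto_pow_atTop_atTop_of_one_lt (by norm_num)
  have hl := ((hd x).hasFDerivAt.lim_real h).comp ht
  have hl2 : Filter.Tendsto (fun n : ℕ => |u (x + h) - u x
      - 2 ^ n * (u (x + ((2 : ℝ) ^ n)⁻¹ • h) - u x)|) Filter.atTop
      (nhds |u (x + h) - u x - fderiv ℝ u x h|) := (hl.const_sub _).abs
  refine le_of_tendsto hl2 (Filter.Eventually.of_forall fun n => (key n).trans ?_)
  have hM : 0 ≤ M * ‖h‖ ^ 2 := (abs_nonneg _).trans (hu x h)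
  have : 0 < ((2 : ℝ) ^ n)⁻¹ := by positivity
  nlinarith

theorem SecondDifferenceBound.norm_fderiv_sub_le {M : ℝ} (hM : 0 ≤ M) {u : V → ℝ}
    (hu : SecondDifferenceBound M u) (hd : Differentiable ℝ u) (x y : V) :
    ‖fderiv ℝ u y - fderiv ℝ u x‖ ≤ 3 * M * ‖y - x‖ := by
  rcases eq_or_ne y x with rfl | hxy
  · simp
  have hp : 0 < ‖y - x‖ := norm_pos_iff.2 (sub_ne_zero.2 hxy)
  refine ContinuousLinearMap.norm_le_of_sphere _ hp (by positivity) fun h hh => ?_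
  have h1 := hu.abs_taylor_le hd x (y - x + h)
  have h2 := hu.abs_taylor_le hd x (y - x)
  have h3 := hu.abs_taylor_le hd y h
  have e : x + (y - x + h) = y + h := by abel
  rw [e, map_add] at h1
  rw [add_sub_cancel] at h2
  have h4 : ‖y - x + h‖ ≤ 2 * ‖y - x‖ := (norm_add_le _ _).trans (by linarith)
  have h5 : ‖y - x + h‖ ^ 2 ≤ (2 * ‖y - x‖) ^ 2 := by gcongr
  have h6 := mul_le_mul_of_nonneg_left h5 (by positivity : 0 ≤ M / 2)
  rw [hh] at h3
  rw [FunLike.coe_sub, Pi.sub_apply]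
  rw [abs_le] at *
  constructor <;> nlinarith [h1.1, h1.2, h2.1, h2.2, h3.1, h3.2]

theorem SecondDifferenceBound.norm_iteratedFDeriv_two_le {M : ℝ} (hM : 0 ≤ M) {u : V → ℝ}
    (hu : SecondDifferenceBound M u) (hd : Differentiable ℝ u) (x : V) :
    ‖iteratedFDeriv ℝ 2 u x‖ ≤ 3 * M := by
  rw [← norm_iteratedFDeriv_fderiv, norm_iteratedFDeriv_one]
  have : LipschitzWith ⟨3 * M, by positivity⟩ (fderiv ℝ u) :=
    LipschitzWith.of_dist_le_mul fun y x => by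
      rw [dist_eq_norm, dist_eq_norm]
      exact hu.norm_fderiv_sub_le hM hd x y
  exact norm_fderiv_le_of_lipschitz ℝ this

theorem SecondDifferenceBound.norm_fderiv_le {M K ρ : ℝ} (hM : 0 ≤ M) (hρ : 0 < ρ)
    {u : V → ℝ} (hu : SecondDifferenceBound M u) (hd : Differentiable ℝ u) {x : V}
    (hK : ∀ h, ‖h‖ = ρ → |u (x + h) - u x| ≤ K * ρ ^ 2) (hK0 : 0 ≤ K) :
    ‖fderiv ℝ u x‖ ≤ (K + M / 2) * ρ := by
  refine ContinuousLinearMap.norm_le_of_sphere _ hρ (by positivity) fun h hh => ?_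
  have h1 := hu.abs_taylor_le hd x h
  have h2 := hK h hh
  rw [hh] at h1
  rw [abs_le] at *
  constructor <;> nlinarith [h1.1, h1.2, h2.1, h2.2]

theorem norm_iteratedFDeriv_cutoff_mul_le {χ v : V → ℝ} {C K r : ℝ} (hC : 0 ≤ C) (hK : 0 ≤ K)
    (hr : 0 < r) (hχ : ContDiff ℝ 2 χ) (hv : ContDiff ℝ 2 v) (z y : V)
    (hχC : ∀ i ≤ 2, ∀ y, ‖iteratedFDeriv ℝ i χ y‖ ≤ C)
    (hvK : ∀ i ≤ 2, ‖iteratedFDeriv ℝ i v y‖ ≤ K * r ^ (2 - i)) {i : ℕ} (hi : i ≤ 2) :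
    ‖iteratedFDeriv ℝ i (fun y => χ (r⁻¹ • (y - z)) * v y) y‖ ≤ 4 * C * K * r ^ (2 - i) := by
  have hχs : ContDiff ℝ 2 fun y : V => χ (r⁻¹ • y) := hχ.comp (contDiff_const_smul _)
  have hχr : ContDiff ℝ 2 fun y : V => χ (r⁻¹ • (y - z)) :=
    hχs.comp (contDiff_id.sub contDiff_const)
  have hd : ∀ j ≤ 2, ‖iteratedFDeriv ℝ j (fun y : V => χ (r⁻¹ • (y - z))) y‖ ≤ r⁻¹ ^ j * C := by
    intro j hj
    have e := iteratedFDeriv_comp_sub (𝕜 := ℝ) (f := fun y : V => χ (r⁻¹ • y)) j z y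
    rw [e, iteratedFDeriv_comp_const_smul _ (hχ.of_le (by exact_mod_cast hj)), norm_smul,
      norm_pow, Real.norm_of_nonneg (by positivity)]
    gcongr
    exact hχC j hj _
  refine (norm_iteratedFDeriv_mul_le hχr hv y (n := i) (by exact_mod_cast hi)).trans ?_
  calc _ ≤ ∑ j ∈ Finset.range (i + 1), (i.choose j : ℝ) * (C * K * r ^ (2 - i)) := by
        refine Finset.sum_le_sum fun j hj => ?_
        have hji : j ≤ i := Nat.lt_succ_iff.1 (Finset.mem_range.1 hj)
        rw [mul_assoc]
        refine mul_le_mul_of_nonneg_left ?_ (Nat.cast_nonneg _)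
        calc _ ≤ (r⁻¹ ^ j * C) * (K * r ^ (2 - (i - j))) :=
              mul_le_mul (hd j (hji.trans hi)) (hvK (i - j) (by omega)) (norm_nonneg _)
                (by positivity)
          _ = C * K * r ^ (2 - i) := by
              rw [show 2 - (i - j) = (2 - i) + j by omega, pow_add, inv_pow]
              field_simp
    _ = (2 : ℝ) ^ i * (C * K * r ^ (2 - i)) := by
        rw [← Finset.sum_mul]
        congr 1
        exact_mod_cast Nat.sum_range_choose i
    _ ≤ 2 ^ 2 * (C * K * r ^ (2 - i)) := by
        gcongr
        norm_num
    _ = _ := by ring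
end

section
variable {V : Type*} [NormedAddCommGroup V] [InnerProductSpace ℝ V] [FiniteDimensional ℝ V]

open MeasureTheory in
/-- Mollification at scale `ε`. -/
theorem SecondDifferenceBound.exists_smooth_approx {M : ℝ} (hM : 0 ≤ M)
    {F : V → ℝ} (hF : SecondDifferenceBound M F) (hc : Continuous F) (hF0 : ∀ x, 0 ≤ F x)
    {ε : ℝ} (hε : 0 < ε) :
    ∃ u : V → ℝ, ContDiff ℝ 2 u ∧ SecondDifferenceBound M u ∧ (∀ x, 0 ≤ u x) ∧
      ∀ x, |u x - F x| ≤ M / 2 * ε ^ 2 := by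
  borelize V
  let μ : Measure V := volume
  let φ : ContDiffBump (0 : V) := ⟨ε / 2, ε, by positivity, by linarith⟩
  let η : V → ℝ := φ.normed μ
  have hη0 : ∀ t, 0 ≤ η t := φ.nonneg_normed
  have hηc : Continuous η := φ.continuous_normed
  have hηs : HasCompactSupport η := φ.hasCompactSupport_normed
  have hη1 : ∫ t, η t ∂μ = 1 := φ.integral_normed
  have hint : ∀ g : V → ℝ, Continuous g → Integrable (fun t => η t * g t) μ := fun g hg =>
    (hηc.mul hg).integrable_of_hasCompactSupport hηs.mul_right
  have hbd : ∀ (g : V → ℝ) (C : ℝ), Continuous g → (∀ t, ‖t‖ ≤ ε → |g t| ≤ C) →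
      |∫ t, η t * g t ∂μ| ≤ C := by
    intro g C hg hC
    calc |∫ t, η t * g t ∂μ| ≤ ∫ t, η t * C ∂μ := by
          rw [← Real.norm_eq_abs]
          refine norm_integral_le_of_norm_le (hint (fun _ => C) continuous_const) (.of_forall fun t => ?_)
          rw [norm_mul, Real.norm_of_nonneg (hη0 t)]
          by_cases ht : ‖t‖ ≤ ε
          · exact mul_le_mul_of_nonneg_left (hC t ht) (hη0 t)
          · have : η t = 0 := by
              by_contra h
              have : t ∈ Function.support (φ.normed μ) := h
              rw [φ.support_normed_eq, mem_ball_zero_iff] at this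
              exact ht this.le
            simp [this]
      _ = C := by rw [integral_mul_const, hη1, one_mul]
  have hcm : ∀ x, Continuous fun t => F (x - t) := fun x => by fun_prop
  have hcp : ∀ x, Continuous fun t => F (x + t) := fun x => by fun_prop
  have hconst : ∀ c : ℝ, ∫ t, η t * c ∂μ = c := fun c => by
    rw [integral_mul_const, hη1, one_mul]
  have hlin : ∀ f g k : V → ℝ, Continuous f → Continuous g → Continuous k →
      ∫ t, η t * (f t + g t - 2 * k t) ∂μ
        = (∫ t, η t * f t ∂μ) + (∫ t, η t * g t ∂μ) - 2 * ∫ t, η t * k t ∂μ := by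
    intro f g k hf hg hk
    have h1 : Integrable (fun t => η t * f t + η t * g t) μ := (hint f hf).add (hint g hg)
    rw [← integral_const_mul, ← integral_add (hint f hf) (hint g hg),
      ← integral_sub h1 ((hint k hk).const_mul 2)]
    congr 1
    ext t
    ring
  refine ⟨fun x => ∫ t, η t * F (x - t) ∂μ, ?_, ?_, ?_, ?_⟩
  · exact hηs.contDiff_convolution_left (n := 2) (ContinuousLinearMap.mul ℝ ℝ)
      φ.contDiff_normed hc.locallyIntegrable
  · intro x h
    have e := hlin _ _ _ (hcm (x + h)) (hcm (x - h)) (hcm x)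
    have e2 : ∀ t, F (x + h - t) + F (x - h - t) - 2 * F (x - t)
        = F (x - t + h) + F (x - t - h) - 2 * F (x - t) := fun t => by
      rw [show x + h - t = x - t + h by abel, show x - h - t = x - t - h by abel]
    simp only [e2] at e
    simp only [← e]
    exact hbd _ _ (by fun_prop) fun t _ => hF _ _
  · exact fun x => integral_nonneg fun t => mul_nonneg (hη0 t) (hF0 _)
  · intro x
    have e1 : ∫ t, η t * F (x - t) ∂μ = ∫ t, η t * F (x + t) ∂μ := by
      rw [← integral_neg_eq_self]
      congr 1
      ext t
      rw [sub_neg_eq_add]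
      congr 1
      exact φ.normed_neg t
    have e := hlin _ _ _ (hcp x) (hcm x) (continuous_const (y := F x))
    rw [hconst, ← e1] at e
    have h1 : |∫ t, η t * (F (x + t) + F (x - t) - 2 * F x) ∂μ| ≤ M * ε ^ 2 :=
      hbd _ _ (by fun_prop) fun t ht => (hF x t).trans (by gcongr)
    rw [e, ← two_mul, ← mul_sub, abs_mul, abs_of_pos two_pos] at h1
    linarith
end
section
variable {V : Type*} [NormedAddCommGroup V] [InnerProductSpace ℝ V] [FiniteDimensional ℝ V]

/-- The largest function lying below all the upper paraboloids
`c z + G z x + (M / 2) ‖x - z‖²` which becomes convex after adding `(M / 2) ‖x‖²` lies above the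
lower paraboloids, and its second differences are bounded by `M`. -/
theorem exists_semiconvex_envelope {S : Set V} (hS : S.Nonempty) {M : ℝ} (hM : 0 ≤ M)
    (c : V → ℝ) (G : V → V →L[ℝ] ℝ)
    (hpos : ∀ z ∈ S, ∀ x, 0 ≤ c z + G z x + M / 2 * ‖x - z‖ ^ 2)
    (hcomp : ∀ z ∈ S, ∀ w ∈ S, ∀ x,
      c z + G z x - M / 2 * ‖x - z‖ ^ 2 ≤ c w + G w x + M / 2 * ‖x - w‖ ^ 2) :
    ∃ F : V → ℝ, Continuous F ∧ (∀ x, 0 ≤ F x) ∧ SecondDifferenceBound M F ∧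
      ∀ z ∈ S, ∀ x, |F x - (c z + G z x)| ≤ M / 2 * ‖x - z‖ ^ 2 := by
  obtain ⟨z₀, hz₀⟩ := hS
  let A : Set (V → ℝ) := {u | ConvexOn ℝ Set.univ (fun x => u x + M / 2 * ‖x‖ ^ 2) ∧
    ∀ z ∈ S, ∀ x, u x ≤ c z + G z x + M / 2 * ‖x - z‖ ^ 2}
  have hsq : ConvexOn ℝ Set.univ (fun x : V => M / 2 * ‖x‖ ^ 2) :=
    (convexOn_univ_norm.pow (fun _ _ => norm_nonneg _) 2).smul (by positivity)
  have h0 : (fun _ => 0 : V → ℝ) ∈ A := ⟨by simpa using hsq, hpos⟩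
  let F : V → ℝ := fun x => sSup ((fun u : V → ℝ => u x) '' A)
  have hle : ∀ u ∈ A, ∀ x, u x ≤ F x := fun u hu x =>
    le_csSup ⟨c z₀ + G z₀ x + M / 2 * ‖x - z₀‖ ^ 2, by rintro _ ⟨w, hw, rfl⟩; exact hw.2 z₀ hz₀ x⟩
      ⟨u, hu, rfl⟩
  have hsup : ∀ x b, (∀ u ∈ A, u x ≤ b) → F x ≤ b := fun x b hb =>
    csSup_le (Set.Nonempty.image _ ⟨_, h0⟩) (by rintro _ ⟨u, hu, rfl⟩; exact hb u hu)
  have hup : ∀ z ∈ S, ∀ x, F x ≤ c z + G z x + M / 2 * ‖x - z‖ ^ 2 := fun z hz x =>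
    hsup x _ fun u hu => hu.2 z hz x
  have hconv : ConvexOn ℝ Set.univ (fun x => F x + M / 2 * ‖x‖ ^ 2) := by
    refine ⟨convex_univ, fun x _ y _ a b ha hb hab => ?_⟩
    rw [← le_sub_iff_add_le]
    refine hsup _ _ fun u hu => ?_
    have h1 := hu.1.2 (Set.mem_univ x) (Set.mem_univ y) ha hb hab
    have h2 := mul_le_mul_of_nonneg_left (hle u hu x) ha
    have h3 := mul_le_mul_of_nonneg_left (hle u hu y) hb
    simp only [smul_eq_mul] at h1 ⊢
    linarith
  have hnorm : ∀ x h : V, ‖x + h‖ ^ 2 + ‖x - h‖ ^ 2 = 2 * ‖x‖ ^ 2 + 2 * ‖h‖ ^ 2 := fun x h => by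
    rw [norm_add_sq_real, norm_sub_sq_real]; ring
  refine ⟨F, ?_, fun x => hle _ h0 x, ?_, ?_⟩
  · have h1 : Continuous fun x => F x + M / 2 * ‖x‖ ^ 2 := hconv.locallyLipschitz.continuous
    have h2 : F = fun x => (F x + M / 2 * ‖x‖ ^ 2) - M / 2 * ‖x‖ ^ 2 := by ext x; ring
    rw [h2]
    exact h1.sub (by fun_prop)
  · intro x h
    have hH : (fun x => (F (x + h) + F (x - h)) / 2 - M / 2 * ‖h‖ ^ 2) ∈ A := by
      constructor
      · refine ⟨convex_univ, fun x _ y _ a b ha hb hab => ?_⟩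
        have h1 := hconv.2 (Set.mem_univ (x + h)) (Set.mem_univ (y + h)) ha hb hab
        have h2 := hconv.2 (Set.mem_univ (x - h)) (Set.mem_univ (y - h)) ha hb hab
        have e1 : a • (x + h) + b • (y + h) = a • x + b • y + h := by
          obtain rfl : b = 1 - a := by linarith
          module
        have e2 : a • (x - h) + b • (y - h) = a • x + b • y - h := by
          obtain rfl : b = 1 - a := by linarith
          module
        rw [e1] at h1
        rw [e2] at h2
        have n1 := congrArg (M / 4 * ·) (hnorm (a • x + b • y) h)
        have n2 := congrArg (a * M / 4 * ·) (hnorm x h)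
        have n3 := congrArg (b * M / 4 * ·) (hnorm y h)
        have n4 := congrArg (M * ‖h‖ ^ 2 * ·) hab
        simp only [smul_eq_mul] at h1 h2 n1 n2 n3 n4 ⊢
        linarith
      · intro z hz x
        have h1 := hup z hz (x + h)
        have h2 := hup z hz (x - h)
        have n1 := congrArg (M / 4 * ·) (hnorm (x - z) h)
        rw [map_add, add_sub_right_comm] at h1
        rw [map_sub, sub_right_comm] at h2
        simp only at n1 ⊢
        linarith
    have h1 := hle _ hH x
    have h2 := hconv.2 (Set.mem_univ (x + h)) (Set.mem_univ (x - h))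
      (by norm_num : (0 : ℝ) ≤ 1 / 2) (by norm_num : (0 : ℝ) ≤ 1 / 2) (by norm_num)
    have e1 : (1 / 2 : ℝ) • (x + h) + (1 / 2 : ℝ) • (x - h) = x := by module
    rw [e1] at h2
    have n1 := congrArg (M / 4 * ·) (hnorm x h)
    simp only [smul_eq_mul] at h1 h2 n1
    rw [abs_le]
    constructor <;> linarith
  · intro z hz x
    have hlow : (fun x => c z + G z x - M / 2 * ‖x - z‖ ^ 2) ∈ A := by
      refine ⟨?_, fun w hw x => hcomp z hz w hw x⟩
      have e : (fun x => c z + G z x - M / 2 * ‖x - z‖ ^ 2 + M / 2 * ‖x‖ ^ 2)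
          = fun x => (G z + M • innerSL ℝ z) x + (c z - M / 2 * ‖z‖ ^ 2) := by
        ext x
        simp only [FunLike.coe_add, FunLike.coe_smul, Pi.add_apply, Pi.smul_apply,
          innerSL_apply_apply, smul_eq_mul]
        rw [norm_sub_sq_real, real_inner_comm]
        ring
      rw [e]
      exact ((G z + M • innerSL ℝ z).toLinearMap.convexOn convex_univ).add_const _
    have h1 := hle _ hlow x
    have h2 := hup z hz x
    rw [abs_le]
    constructor <;> linarith

theorem exists_contDiff_cutoff (V : Type*) [NormedAddCommGroup V] [InnerProductSpace ℝ V]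
    [FiniteDimensional ℝ V] :
    ∃ (χ : V → ℝ) (C : ℝ), 0 < C ∧ ContDiff ℝ 2 χ ∧ (∀ y, 0 ≤ χ y ∧ χ y ≤ 1) ∧
      (∀ y, ‖y‖ ≤ 1 → χ y = 1) ∧ (∀ y, 2 ≤ ‖y‖ → χ y = 0) ∧
      ∀ i ≤ 2, ∀ y, ‖iteratedFDeriv ℝ i χ y‖ ≤ C := by
  let φ : ContDiffBump (0 : V) := ⟨1, 2, one_pos, one_lt_two⟩
  have hφ : ContDiff ℝ 2 φ := φ.contDiff
  have hb : ∀ i : ℕ, i ≤ 2 → ∃ C : ℝ, ∀ y, ‖iteratedFDeriv ℝ i φ y‖ ≤ C := fun i hi =>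
    (φ.hasCompactSupport.iteratedFDeriv i).exists_bound_of_continuous
      (hφ.continuous_iteratedFDeriv (by exact_mod_cast hi))
  obtain ⟨C₀, h0⟩ := hb 0 (by norm_num)
  obtain ⟨C₁, h1⟩ := hb 1 (by norm_num)
  obtain ⟨C₂, h2⟩ := hb 2 le_rfl
  refine ⟨φ, 1 + |C₀| + |C₁| + |C₂|, by positivity, hφ, fun y => ⟨φ.nonneg, φ.le_one⟩,
    fun y hy => φ.one_of_mem_closedBall (by simpa using hy),
    fun y hy => φ.zero_of_le_dist (by simpa using hy), fun i hi y => ?_⟩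
  have a0 := abs_nonneg C₀
  have a1 := abs_nonneg C₁
  have a2 := abs_nonneg C₂
  interval_cases i
  · exact (h0 y).trans (by linarith [le_abs_self C₀])
  · exact (h1 y).trans (by linarith [le_abs_self C₁])
  · exact (h2 y).trans (by linarith [le_abs_self C₂])

end

section
variable {V : Type*} [NormedAddCommGroup V] [InnerProductSpace ℝ V]

theorem secondDifference_paraboloid (c M : ℝ) (G : V →L[ℝ] ℝ) (z x h : V) :
    (c + G (x + h) + M / 2 * ‖x + h - z‖ ^ 2) + (c + G (x - h) + M / 2 * ‖x - h - z‖ ^ 2)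
      - 2 * (c + G x + M / 2 * ‖x - z‖ ^ 2) = M * ‖h‖ ^ 2 := by
  rw [add_sub_right_comm x h z, sub_right_comm x h z, norm_add_sq_real (x - z) h,
    norm_sub_sq_real (x - z) h, map_add, map_sub]
  ring

theorem hasFDerivAt_paraboloid (c M : ℝ) (G : V →L[ℝ] ℝ) (z : V) :
    HasFDerivAt (fun y => c + G y + M / 2 * ‖y - z‖ ^ 2) G z := by
  have h1 : HasFDerivAt (fun y : V => y - z) (ContinuousLinearMap.id ℝ V) z :=
    (hasFDerivAt_id z).sub_const z
  have h := (G.hasFDerivAt (x := z).const_add c).add (h1.norm_sq.const_mul (M / 2))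
  refine h.congr_fderiv ?_
  ext v
  simp

end

theorem Finset.exists_separation_radius {V : Type*} [NormedAddCommGroup V] (E : Finset V) :
    ∃ r : ℝ, 0 < r ∧ r ≤ 1 ∧ ∀ z ∈ E, ∀ w ∈ E, z ≠ w → 4 * r < ‖z - w‖ := by
  have h : ∀ᶠ r : ℝ in nhdsWithin 0 (Set.Ioi 0), ∀ p ∈ E.offDiag, 4 * r < ‖p.1 - p.2‖ := by
    refine (Filter.eventually_all_finset _).2 fun p hp => ?_
    have hp' : 0 < ‖p.1 - p.2‖ := norm_pos_iff.2 (sub_ne_zero.2 (Finset.mem_offDiag.1 hp).2.2)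
    have : Filter.Tendsto (fun r : ℝ => 4 * r) (nhds 0) (nhds (4 * 0)) :=
      Filter.Tendsto.const_mul 4 Filter.tendsto_id
    rw [mul_zero] at this
    exact (this.eventually (gt_mem_nhds hp')).filter_mono nhdsWithin_le_nhds
  have h1 : ∀ᶠ r : ℝ in nhdsWithin 0 (Set.Ioi 0), r ≤ 1 :=
    (ge_mem_nhds one_pos : ∀ᶠ r : ℝ in nhds 0, r ≤ 1).filter_mono nhdsWithin_le_nhds
  obtain ⟨r, ⟨hr, hr1⟩, hr0⟩ := ((h.and h1).and self_mem_nhdsWithin).exists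
  exact ⟨r, hr0, hr1, fun z hz w hw hzw => hr (z, w) (Finset.mem_offDiag.2 ⟨hz, hw, hzw⟩)⟩

/-- A nonnegative function with bounded second differences that osculates given affine jets on a
finite set can be replaced by a nonnegative `C²` function with exactly these jets. -/
theorem exists_contDiff_of_secondDifferenceBound (V : Type*) [NormedAddCommGroup V]
    [InnerProductSpace ℝ V] [FiniteDimensional ℝ V] :
    ∃ C : ℝ, 0 < C ∧ ∀ (E : Finset V) (M B : ℝ) (c : V → ℝ) (G : V → V →L[ℝ] ℝ) (F : V → ℝ),
      0 ≤ M → 0 ≤ B → Continuous F → SecondDifferenceBound M F → (∀ x, 0 ≤ F x ∧ F x ≤ B) →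
      (∀ z ∈ E, ∀ x, 0 ≤ c z + G z x + M / 2 * ‖x - z‖ ^ 2) →
      (∀ z ∈ E, ∀ x, |F x - (c z + G z x)| ≤ M / 2 * ‖x - z‖ ^ 2) →
      ∃ H : V → ℝ, (∀ x, 0 ≤ H x) ∧ ContDiff ℝ 2 H ∧
        (∀ x, ∀ i ≤ 2, ‖iteratedFDeriv ℝ i H x‖ ≤ C * (M + B)) ∧
        ∀ z ∈ E, H z = c z + G z z ∧ fderiv ℝ H z = G z := by
  obtain ⟨χ, C, hC, hχ, hχ01, hχ1, hχ0, hχC⟩ := exists_contDiff_cutoff V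
  refine ⟨3 + 64 * C, by positivity, ?_⟩
  intro E M B c G F hM hB hFc hF hFB hpos hjet
  obtain ⟨r, hr, hr1, hsep⟩ := E.exists_separation_radius
  obtain ⟨u, huC, hu, hu0, huF⟩ := hF.exists_smooth_approx hM hFc (fun x => (hFB x).1) hr
  have hr2 : r ^ 2 ≤ 1 := pow_le_one₀ hr.le hr1
  let p : V → V → ℝ := fun z y => c z + G z y + M / 2 * ‖y - z‖ ^ 2
  have hpC : ∀ z, ContDiff ℝ 2 (p z) := fun z =>
    (contDiff_const.add (G z).contDiff).add
      (contDiff_const.mul ((contDiff_id.sub contDiff_const).norm_sq ℝ))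
  let v : V → V → ℝ := fun z y => p z y - u y
  have hvC : ∀ z, ContDiff ℝ 2 (v z) := fun z => (hpC z).sub huC
  have hv2 : ∀ z, SecondDifferenceBound (2 * M) (v z) := by
    intro z x h
    have h1 := hu x h
    have h2 : p z (x + h) + p z (x - h) - 2 * p z x = M * ‖h‖ ^ 2 :=
      secondDifference_paraboloid (c z) M (G z) z x h
    simp only [v]
    rw [abs_le] at *
    constructor <;> linarith
  have hv : ∀ z ∈ E, ∀ y, |v z y| ≤ M * ‖y - z‖ ^ 2 + M / 2 * r ^ 2 := by
    intro z hz y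
    have h1 := hjet z hz y
    have h2 := huF y
    simp only [v, p]
    rw [abs_le] at *
    constructor <;> linarith
  have hvK : ∀ z ∈ E, ∀ y, ‖y - z‖ ≤ 2 * r → ∀ i ≤ 2,
      ‖iteratedFDeriv ℝ i (v z) y‖ ≤ 16 * M * r ^ (2 - i) := by
    intro z hz y hy i hi
    have hvd : Differentiable ℝ (v z) := (hvC z).differentiable (by norm_num)
    have hb : ∀ x k, 0 ≤ k → ‖x - z‖ ≤ k * r → |v z x| ≤ M * (k ^ 2 + 1 / 2) * r ^ 2 := by
      intro x k hk hx
      have h1 : ‖x - z‖ ^ 2 ≤ (k * r) ^ 2 := by gcongr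
      have h2 := mul_le_mul_of_nonneg_left h1 hM
      linarith [hv z hz x]
    have hy2 := hb y 2 (by norm_num) hy
    have hMr : 0 ≤ M * r ^ 2 := by positivity
    interval_cases i
    · rw [norm_iteratedFDeriv_zero, Real.norm_eq_abs, Nat.sub_zero]
      linarith
    · rw [norm_iteratedFDeriv_one]
      have h1 := (hv2 z).norm_fderiv_le (K := 15 * M) (by positivity) hr hvd (x := y)
        (fun h hh => by
          have h3 := hb (y + h) 3 (by norm_num) (by
            rw [add_sub_right_comm]
            exact (norm_add_le _ _).trans (by linarith))
          rw [abs_le] at *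
          constructor <;> linarith) (by positivity)
      exact h1.trans (le_of_eq (by ring))
    · refine ((hv2 z).norm_iteratedFDeriv_two_le (by positivity) hvd y).trans ?_
      norm_num
      linarith
  let w : V → V → ℝ := fun z y => χ (r⁻¹ • (y - z)) * v z y
  have hwC : ∀ z, ContDiff ℝ 2 (w z) := fun z =>
    (hχ.comp (contDiff_const.smul (contDiff_id.sub contDiff_const))).mul (hvC z)
  have hscale : ∀ y : V, ‖r⁻¹ • y‖ = ‖y‖ / r := fun y => by
    rw [norm_smul, Real.norm_of_nonneg (by positivity)]; field_simp
  have hw0 : ∀ z y, 2 * r ≤ ‖y - z‖ → w z y = 0 := fun z y hy => by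
    simp only [w]
    rw [hχ0 _ (by rwa [hscale, le_div_iff₀ hr]), zero_mul]
  have hwD0 : ∀ z y, 2 * r < ‖y - z‖ → ∀ i : ℕ, iteratedFDeriv ℝ i (w z) y = 0 := by
    intro z y hy i
    have hts : tsupport (w z) ⊆ Metric.closedBall z (2 * r) := by
      refine closure_minimal (fun x hx => ?_) Metric.isClosed_closedBall
      rw [mem_closedBall_iff_norm]
      by_contra h
      exact hx (hw0 z x (not_le.1 h).le)
    by_contra h
    have h1 := hts (support_iteratedFDeriv_subset (𝕜 := ℝ) i (Function.mem_support.2 h))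
    rw [mem_closedBall_iff_norm] at h1
    linarith
  have hwK : ∀ z ∈ E, ∀ y, ‖y - z‖ ≤ 2 * r → ∀ i ≤ 2,
      ‖iteratedFDeriv ℝ i (w z) y‖ ≤ 64 * C * M := by
    intro z hz y hy i hi
    have h1 := norm_iteratedFDeriv_cutoff_mul_le hC.le (by positivity : 0 ≤ 16 * M) hr hχ (hvC z)
      z y hχC (hvK z hz y hy) hi
    have h2 : r ^ (2 - i) ≤ 1 := pow_le_one₀ hr.le hr1
    refine h1.trans ?_
    have h3 : 0 ≤ 4 * C * (16 * M) := by positivity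
    nlinarith
  have hfar : ∀ z ∈ E, ∀ z' ∈ E, z' ≠ z → ∀ y, ‖y - z‖ ≤ 2 * r → 2 * r < ‖y - z'‖ := by
    intro z hz z' hz' hne y hy
    have h1 := hsep z' hz' z hz hne
    have h2 : ‖z' - z‖ ≤ ‖y - z'‖ + ‖y - z‖ := by
      rw [norm_sub_rev y z']
      exact norm_sub_le_norm_sub_add_norm_sub z' y z
    linarith
  have hnear : ∀ z ∈ E, ∀ y, ‖y - z‖ ≤ 2 * r → u y + ∑ z' ∈ E, w z' y = u y + w z y :=
    fun z hz y hy => by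
      rw [Finset.sum_eq_single_of_mem z hz fun z' hz' hne =>
        hw0 z' y (hfar z hz z' hz' hne y hy).le]
  refine ⟨fun y => u y + ∑ z ∈ E, w z y, ?_, ?_, ?_, ?_⟩
  · intro y
    by_cases h : ∃ z ∈ E, ‖y - z‖ ≤ 2 * r
    · obtain ⟨z, hz, hy⟩ := h
      simp only [hnear z hz y hy]
      have e : u y + w z y = (1 - χ (r⁻¹ • (y - z))) * u y + χ (r⁻¹ • (y - z)) * p z y := by
        simp only [w, v]; ring
      rw [e]
      have h1 := hχ01 (r⁻¹ • (y - z))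
      exact add_nonneg (mul_nonneg (by linarith [h1.2]) (hu0 y)) (mul_nonneg h1.1 (hpos z hz y))
    · push Not at h
      simp only
      rw [Finset.sum_eq_zero fun z hz => hw0 z y (h z hz).le, add_zero]
      exact hu0 y
  · exact huC.add (ContDiff.sum fun z _ => hwC z)
  · intro y i hi
    have hi' : (i : WithTop ℕ∞) ≤ 2 := by exact_mod_cast hi
    rw [fun_iteratedFDeriv_add_apply (huC.of_le hi').contDiffAt
      (ContDiff.sum fun z _ => (hwC z).of_le hi').contDiffAt,
      iteratedFDeriv_fun_sum_apply fun z _ => ((hwC z).of_le hi').contDiffAt]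
    have hMB : 0 ≤ 64 * C * B := by positivity
    have hsum : ‖∑ z ∈ E, iteratedFDeriv ℝ i (w z) y‖ ≤ 64 * C * M := by
      by_cases h : ∃ z ∈ E, ‖y - z‖ ≤ 2 * r
      · obtain ⟨z, hz, hy⟩ := h
        rw [Finset.sum_eq_single_of_mem z hz fun z' hz' hne =>
          hwD0 z' y (hfar z hz z' hz' hne y hy) i]
        exact hwK z hz y hy i hi
      · push Not at h
        rw [Finset.sum_eq_zero fun z hz => hwD0 z y (h z hz) i, norm_zero]
        positivity
    have hub : ∀ x, 0 ≤ u x ∧ u x ≤ B + M / 2 := fun x => by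
      have h1 := (abs_le.1 (huF x)).2
      have h2 := (hFB x).2
      exact ⟨hu0 x, by nlinarith⟩
    have hud : Differentiable ℝ u := huC.differentiable (by norm_num)
    have huK : ‖iteratedFDeriv ℝ i u y‖ ≤ 3 * (M + B) := by
      interval_cases i
      · rw [norm_iteratedFDeriv_zero, Real.norm_of_nonneg (hu0 y)]
        linarith [(hub y).2]
      · rw [norm_iteratedFDeriv_one]
        have h1 := hu.norm_fderiv_le (K := B + M / 2) hM one_pos hud (x := y) (fun h _ => by
          have h3 := hub (y + h)
          have h4 := hub y
          rw [abs_le]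
          constructor <;> linarith) (by positivity)
        linarith
      · linarith [hu.norm_iteratedFDeriv_two_le hM hud y]
    refine (norm_add_le _ _).trans ?_
    linarith
  · intro z hz
    have hev : (fun y => u y + ∑ z' ∈ E, w z' y) =ᶠ[nhds z] p z := by
      filter_upwards [Metric.ball_mem_nhds z hr] with y hy
      rw [mem_ball_iff_norm] at hy
      rw [hnear z hz y (by linarith)]
      simp only [w, v]
      rw [hχ1 _ (by rw [hscale, div_le_one hr]; exact hy.le)]
      ring
    refine ⟨?_, ?_⟩
    · refine hev.eq_of_nhds.trans ?_
      simp [p]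
    · rw [hev.fderiv_eq]
      exact (hasFDerivAt_paraboloid (c z) M (G z) z).fderiv

theorem Finset.le_biSup_real {α : Type*} (S : Finset α) {g : α → ℝ} (hg : ∀ x ∈ S, 0 ≤ g x)
    {x : α} (hx : x ∈ S) : g x ≤ ⨆ y ∈ (S : Set α), g y := by
  have hbdd : BddAbove (Set.range fun y => ⨆ _ : y ∈ (S : Set α), g y) := by
    refine ⟨∑ y ∈ S, g y, ?_⟩
    rintro _ ⟨y, rfl⟩
    by_cases hy : y ∈ S
    · simpa [hy] using Finset.single_le_sum hg hy
    · simpa [hy] using Finset.sum_nonneg hg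
  refine le_trans ?_ (le_ciSup hbdd x)
  simp [hx]

theorem Finset.biSup_real_nonneg {α : Type*} (S : Finset α) {g : α → ℝ}
    (hg : ∀ x ∈ S, 0 ≤ g x) : 0 ≤ ⨆ y ∈ (S : Set α), g y :=
  Real.iSup_nonneg fun y => Real.iSup_nonneg fun hy => hg y hy

/-- The pointwise estimates encoded by the bound `wPlusNorm E P ≤ A`. -/
structure WhitneyPlusBound (E : Finset E2) (P : E2 → AffPoly) (A : ℝ) : Prop where
  nonneg : 0 ≤ A
  abs_eval_le : ∀ x ∈ E, |evalA (P x) x| ≤ A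
  norm_grad_le : ∀ x ∈ E, ‖(P x).2‖ ≤ A
  abs_eval_sub_le : ∀ x ∈ E, ∀ y ∈ E, |evalA (P x) x - evalA (P y) x| ≤ A * ‖x - y‖ ^ 2
  norm_grad_sub_le : ∀ x ∈ E, ∀ y ∈ E, ‖(P x).2 - (P y).2‖ ≤ A * ‖x - y‖
  add_nonneg : ∀ x ∈ E, ∀ y, 0 ≤ evalA (P x) y + A * ‖y - x‖ ^ 2

theorem whitneyPlusBound_wPlusNorm {E : Finset E2} {P : E2 → AffPoly} (hP : wPlusMem E P) :
    WhitneyPlusBound E P (wPlusNorm E P) := by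
  let g₁ : E2 → ℝ := fun x => max |evalA (P x) x| ‖(P x).2‖
  let g₂ : E2 → E2 → ℝ := fun x y => if x = y then 0 else
    max (|evalA (P x) x - evalA (P y) x| / dist x y ^ 2) (‖(P x).2 - (P y).2‖ / dist x y)
  let g₃ : E2 → ℝ := fun x =>
    sInf {M : ℝ | 0 ≤ M ∧ ∀ y : E2, 0 ≤ evalA (P x) y + M * dist y x ^ 2}
  have hA : wPlusNorm E P = (⨆ x ∈ (E : Set E2), g₁ x) +
    (⨆ x ∈ (E : Set E2), ⨆ y ∈ (E : Set E2), g₂ x y) + ⨆ x ∈ (E : Set E2), g₃ x := rfl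
  have n1 : ∀ x, 0 ≤ g₁ x := fun x => le_max_of_le_left (abs_nonneg _)
  have n2 : ∀ x y, 0 ≤ g₂ x y := fun x y => by
    simp only [g₂]
    split_ifs
    · exact le_rfl
    · exact le_max_of_le_left (by positivity)
  have n3 : ∀ x, 0 ≤ g₃ x := fun x => Real.sInf_nonneg fun M hM => hM.1
  have n2' : ∀ x, 0 ≤ ⨆ y ∈ (E : Set E2), g₂ x y := fun x => E.biSup_real_nonneg fun y _ => n2 x y
  have s1 := E.biSup_real_nonneg fun x _ => n1 x
  have s2 := E.biSup_real_nonneg fun x _ => n2' x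
  have s3 := E.biSup_real_nonneg fun x _ => n3 x
  have l1 : ∀ x ∈ E, g₁ x ≤ wPlusNorm E P := fun x hx => by
    have := E.le_biSup_real (fun x _ => n1 x) hx
    linarith
  have l2 : ∀ x ∈ E, ∀ y ∈ E, g₂ x y ≤ wPlusNorm E P := fun x hx y hy => by
    have h1 := E.le_biSup_real (fun y _ => n2 x y) hy
    have h2 := E.le_biSup_real (fun x _ => n2' x) hx
    linarith
  have l3 : ∀ x ∈ E, g₃ x ≤ wPlusNorm E P := fun x hx => by
    have := E.le_biSup_real (fun x _ => n3 x) hx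
    linarith
  refine ⟨by linarith, fun x hx => (le_max_left _ _).trans (l1 x hx),
    fun x hx => (le_max_right _ _).trans (l1 x hx), fun x hx y hy => ?_, fun x hx y hy => ?_,
    fun x hx y => ?_⟩
  · rcases eq_or_ne x y with rfl | hxy
    · simp
    · have h := l2 x hx y hy
      simp only [g₂, if_neg hxy] at h
      have hd : 0 < dist x y := dist_pos.2 hxy
      have := (le_max_left _ _).trans h
      rwa [div_le_iff₀ (by positivity), dist_eq_norm] at this
  · rcases eq_or_ne x y with rfl | hxy
    · simp
    · have h := l2 x hx y hy
      simp only [g₂, if_neg hxy] at h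
      have hd : 0 < dist x y := dist_pos.2 hxy
      have := (le_max_right _ _).trans h
      rwa [div_le_iff₀ hd, dist_eq_norm] at this
  · rw [← dist_eq_norm]
    obtain ⟨M₀, hM₀⟩ := hP x hx
    rcases eq_or_ne y x with rfl | hxy
    · simpa using hM₀.2 y
    · have hd : 0 < dist y x ^ 2 := pow_pos (dist_pos.2 hxy) 2
      have h1 : -evalA (P x) y / dist y x ^ 2 ≤ g₃ x := by
        refine le_csInf ⟨M₀, hM₀⟩ fun M hM => ?_
        rw [div_le_iff₀ hd]
        linarith [hM.2 y]
      have h2 := (div_le_iff₀ hd).1 (h1.trans (l3 x hx))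
      linarith

theorem evalA_eq_add (Q : AffPoly) (x z : E2) : evalA Q x = evalA Q z + Q.2 (x - z) := by
  simp [evalA]

theorem WhitneyPlusBound.evalA_le {E : Finset E2} {P : E2 → AffPoly} {A : ℝ}
    (h : WhitneyPlusBound E P A) {z : E2} (hz : z ∈ E) (x : E2) :
    evalA (P z) x ≤ A + A * ‖x - z‖ := by
  rw [evalA_eq_add _ x z]
  have h1 := (le_abs_self _).trans (h.abs_eval_le z hz)
  have h2 := (le_abs_self _).trans (((P z).2.le_opNorm (x - z)).trans
    (mul_le_mul_of_nonneg_right (h.norm_grad_le z hz) (norm_nonneg _)))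
  linarith

theorem WhitneyPlusBound.evalA_sub_le {E : Finset E2} {P : E2 → AffPoly} {A : ℝ}
    (h : WhitneyPlusBound E P A) {z w : E2} (hz : z ∈ E) (hw : w ∈ E) (x : E2) :
    evalA (P z) x - evalA (P w) x ≤ 5 * A * (‖x - z‖ ^ 2 + ‖x - w‖ ^ 2) := by
  rw [evalA_eq_add (P z) x z, evalA_eq_add (P w) x z]
  have h1 := (le_abs_self _).trans (h.abs_eval_sub_le z hz w hw)
  have h2 := (le_abs_self _).trans ((((P z).2 - (P w).2).le_opNorm (x - z)).trans
    (mul_le_mul_of_nonneg_right (h.norm_grad_sub_le z hz w hw) (norm_nonneg _)))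
  rw [FunLike.coe_sub, Pi.sub_apply] at h2
  have h3 : ‖z - w‖ ≤ ‖x - z‖ + ‖x - w‖ := by
    rw [norm_sub_rev x z]
    exact norm_sub_le_norm_sub_add_norm_sub z x w
  have hA := h.nonneg
  have h4 : ‖z - w‖ ^ 2 + ‖z - w‖ * ‖x - z‖ ≤ 5 * (‖x - z‖ ^ 2 + ‖x - w‖ ^ 2) := by
    have := norm_nonneg (z - w)
    have := norm_nonneg (x - z)
    have := norm_nonneg (x - w)
    have h5 : ‖z - w‖ ^ 2 ≤ (‖x - z‖ + ‖x - w‖) ^ 2 := by gcongr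
    have h6 : ‖z - w‖ * ‖x - z‖ ≤ (‖x - z‖ + ‖x - w‖) * ‖x - z‖ := by gcongr
    nlinarith [sq_nonneg (‖x - z‖ - ‖x - w‖)]
  have h7 := mul_le_mul_of_nonneg_left h4 hA
  linarith

/-- The field is extended by zero jets to the points at distance at least `1` from `E`, which keeps
the envelope bounded. -/
theorem WhitneyPlusBound.exists_envelope {E : Finset E2} {P : E2 → AffPoly} {A : ℝ}
    (h : WhitneyPlusBound E P A) :
    ∃ F : E2 → ℝ, Continuous F ∧ SecondDifferenceBound (10 * A) F ∧
      (∀ x, 0 ≤ F x ∧ F x ≤ 7 * A) ∧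
      ∀ z ∈ E, ∀ x, |F x - evalA (P z) x| ≤ 10 * A / 2 * ‖x - z‖ ^ 2 := by
  have hA := h.nonneg
  let S : Set E2 := {x | x ∈ E ∨ ∀ z ∈ E, 1 ≤ ‖x - z‖}
  let Q : E2 → AffPoly := fun z => if z ∈ E then P z else 0
  have hQE : ∀ z ∈ E, Q z = P z := fun z hz => if_pos hz
  have hQ0 : ∀ z, z ∉ E → ∀ x, evalA (Q z) x = 0 := fun z hz x => by simp [Q, hz, evalA]
  have hS : S.Nonempty := by
    rcases E.eq_empty_or_nonempty with hE | ⟨z, hz⟩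
    · exact ⟨0, Or.inr (by simp [hE])⟩
    · exact ⟨z, Or.inl hz⟩
  have hpos : ∀ z ∈ E, ∀ x, 0 ≤ evalA (P z) x + 10 * A / 2 * ‖x - z‖ ^ 2 := by
    intro z hz x
    have h1 := h.add_nonneg z hz x
    have : 0 ≤ A * ‖x - z‖ ^ 2 := by positivity
    linarith
  obtain ⟨F, hFc, hF0, hF2, hFj⟩ := exists_semiconvex_envelope hS (M := 10 * A) (by positivity)
    (fun z => (Q z).1) (fun z => (Q z).2) (by
      intro z _ x
      change 0 ≤ evalA (Q z) x + _
      by_cases hzE : z ∈ E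
      · rw [hQE z hzE]
        exact hpos z hzE x
      · rw [hQ0 z hzE]
        positivity) (by
      intro z hz w hw x
      change evalA (Q z) x - _ ≤ evalA (Q w) x + _
      by_cases hzE : z ∈ E
      · rw [hQE z hzE]
        by_cases hwE : w ∈ E
        · rw [hQE w hwE]
          linarith [h.evalA_sub_le hzE hwE x]
        · rw [hQ0 w hwE]
          have h1 : 1 ≤ ‖w - z‖ := (hw.resolve_left hwE) z hzE
          have h2 := h.evalA_le hzE x
          have h3 : ‖w - z‖ ≤ ‖x - w‖ + ‖x - z‖ := by
            rw [norm_sub_rev x w]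
            exact norm_sub_le_norm_sub_add_norm_sub w x z
          have h4 : 1 + ‖x - z‖ ≤ 5 * (‖x - z‖ ^ 2 + ‖x - w‖ ^ 2) := by
            nlinarith [sq_nonneg (‖x - z‖ - ‖x - w‖), sq_nonneg (‖x - z‖ - 1 / 2),
              sq_nonneg (‖x - z‖ + ‖x - w‖ - 1)]
          have h5 := mul_le_mul_of_nonneg_left h4 hA
          linarith
      · rw [hQ0 z hzE]
        have h1 : 0 ≤ 10 * A / 2 * ‖x - z‖ ^ 2 := by positivity
        have h2 : 0 ≤ evalA (Q w) x + 10 * A / 2 * ‖x - w‖ ^ 2 := by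
          by_cases hwE : w ∈ E
          · rw [hQE w hwE]
            exact hpos w hwE x
          · rw [hQ0 w hwE]
            positivity
        linarith)
  have hjet : ∀ z ∈ E, ∀ x, |F x - evalA (P z) x| ≤ 10 * A / 2 * ‖x - z‖ ^ 2 := by
    intro z hz x
    rw [← hQE z hz]
    exact hFj z (Or.inl hz) x
  refine ⟨F, hFc, hF2, fun x => ⟨hF0 x, ?_⟩, hjet⟩
  by_cases hx : ∃ z ∈ E, ‖x - z‖ < 1
  · obtain ⟨z, hz, hxz⟩ := hx
    have h1 := (le_abs_self _).trans (hjet z hz x)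
    have h2 := h.evalA_le hz x
    have h3 := norm_nonneg (x - z)
    have h4 : ‖x - z‖ ^ 2 ≤ 1 := pow_le_one₀ h3 hxz.le
    nlinarith
  · push Not at hx
    have hxE : x ∉ E := fun hxE => by
      have := hx x hxE
      simp at this
      linarith
    have h1 : |F x - evalA (Q x) x| ≤ 10 * A / 2 * ‖x - x‖ ^ 2 := hFj x (Or.inr hx) x
    rw [hQ0 x hxE] at h1
    have h2 := (le_abs_self _).trans h1
    simp at h2
    linarith

/-- Whitney extension for nonnegative Whitney fields:
a map `T_w : W²₊(E) → C²₊(ℝ²)` matching the prescribed one-jets. -/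
theorem statement4 :
    ∃ Cw : ℝ, 0 < Cw ∧
      ∀ E : Finset E2,
        ∃ T : (E2 → AffPoly) → (E2 → ℝ),
          ∀ P : E2 → AffPoly, wPlusMem E P →
            (∀ y, 0 ≤ T P y) ∧ ContDiff ℝ 2 (T P) ∧
            (∀ x : E2, ∀ i : ℕ, i ≤ 2 →
              ‖iteratedFDeriv ℝ i (T P) x‖ ≤ Cw * wPlusNorm E P) ∧
            (∀ x ∈ E, T P x = evalA (P x) x ∧ fderiv ℝ (T P) x = (P x).2) := by
  obtain ⟨C, hC, hext⟩ := exists_contDiff_of_secondDifferenceBound E2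
  refine ⟨17 * C, by positivity, fun E => ?_⟩
  have key : ∀ P : E2 → AffPoly, ∃ H : E2 → ℝ, wPlusMem E P →
      (∀ y, 0 ≤ H y) ∧ ContDiff ℝ 2 H ∧
      (∀ x : E2, ∀ i : ℕ, i ≤ 2 →
        ‖iteratedFDeriv ℝ i H x‖ ≤ 17 * C * wPlusNorm E P) ∧
      (∀ x ∈ E, H x = evalA (P x) x ∧ fderiv ℝ H x = (P x).2) := by
    intro P
    by_cases hP : wPlusMem E P
    · have hA := whitneyPlusBound_wPlusNorm hP
      have hA0 := hA.nonneg
      obtain ⟨F, hFc, hF2, hFB, hFj⟩ := hA.exists_envelope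
      obtain ⟨H, hH0, hH2, hHC, hHj⟩ := hext E (10 * wPlusNorm E P) (7 * wPlusNorm E P)
        (fun z => (P z).1) (fun z => (P z).2) F (by positivity) (by positivity) hFc hF2 hFB
        (fun z hz x => by
          have h1 : 0 ≤ evalA (P z) x + _ := hA.add_nonneg z hz x
          have h2 : 0 ≤ wPlusNorm E P * ‖x - z‖ ^ 2 := by positivity
          unfold evalA at h1
          linarith) hFj
      exact ⟨H, fun _ => ⟨hH0, hH2, fun x i hi => (hHC x i hi).trans (le_of_eq (by ring)), hHj⟩⟩
    · exact ⟨0, fun h => absurd h hP⟩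
  choose T hT using key
  exact ⟨T, hT⟩
end

section
/- For every κ > 0 and every integer n ≥ 1 there exists a constant C(κ,n), depending only on κ and n, such that for every finite set E ⊂ ℝⁿ with #E = N ≥ 2, the set E × E minus its diagonal can be partitioned into subsets E′₁ × E″₁, …, E′_L × E″_L such that: (i) L ≤ C(κ,n)·N, and (ii) for each ℓ = 1, …, L, diam(E′_ℓ) ≤ κ·dist(E′_ℓ, E″_ℓ) and diam(E″_ℓ) ≤ κ·dist(E′_ℓ, E″_ℓ). -/
/-- Euclidean space `ℝⁿ`. -/
abbrev En (n : ℕ) := EuclideanSpace ℝ (Fin n)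

/-- The distance between two sets: `dist(X,Y) = inf{|x−y| : x ∈ X, y ∈ Y}`. -/
noncomputable def setDist {α : Type*} [PseudoMetricSpace α] (X Y : Set α) : ℝ :=
  sInf {d : ℝ | ∃ x ∈ X, ∃ y ∈ Y, d = dist x y}

/-- A finite set has a net of radius `r`, given as the range of a projection `f`. -/
lemma exists_net_projection {α : Type*} [MetricSpace α] {r : ℝ} (hr : 0 ≤ r) (X : Finset α) :
    ∃ f : α → α, (∀ x ∈ X, f x ∈ X ∧ dist x (f x) ≤ r) ∧
      ∀ x ∈ X, ∀ y ∈ X, f x ≠ f y → r < dist (f x) (f y) := by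
  classical
  induction X using Finset.induction_on with
  | empty => exact ⟨id, by simp, by simp⟩
  | insert a X ha ih =>
    obtain ⟨f, hf, hsep⟩ := ih
    have hne : ∀ x ∈ X, x ≠ a := fun x hx h => ha (h ▸ hx)
    by_cases h : ∃ x ∈ X, dist a (f x) ≤ r
    · obtain ⟨z, hz, hza⟩ := h
      refine ⟨Function.update f a (f z), ?_, ?_⟩
      · intro x hx
        rcases Finset.mem_insert.1 hx with rfl | hx
        · simpa using ⟨Or.inr (hf z hz).1, hza⟩
        · simpa [hne x hx] using ⟨Or.inr (hf x hx).1, (hf x hx).2⟩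
      · intro x hx y hy
        rcases Finset.mem_insert.1 hx with rfl | hx' <;>
          rcases Finset.mem_insert.1 hy with rfl | hy'
        · simp
        · simpa [hne y hy'] using hsep z hz y hy'
        · simpa [hne x hx'] using hsep x hx' z hz
        · simpa [hne x hx', hne y hy'] using hsep x hx' y hy'
    · push Not at h
      refine ⟨Function.update f a a, ?_, ?_⟩
      · intro x hx
        rcases Finset.mem_insert.1 hx with rfl | hx
        · simpa using hr
        · simpa [hne x hx] using ⟨Or.inr (hf x hx).1, (hf x hx).2⟩
      · intro x hx y hy
        rcases Finset.mem_insert.1 hx with rfl | hx' <;>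
          rcases Finset.mem_insert.1 hy with rfl | hy'
        · simp
        · simpa [hne y hy'] using fun _ => h y hy'
        · simpa [hne x hx', dist_comm] using fun _ => h x hx'
        · simpa [hne x hx', hne y hy'] using hsep x hx' y hy'

/-- `π k` sends each point of `E` to its ancestor at level `k` in a tree of nested nets of `E`,
the net of level `k` being `2 ^ k * s`-separated. -/
structure IsNetHierarchy {α : Type*} [MetricSpace α] (E : Finset α) (s : ℝ)
    (π : ℕ → α → α) : Prop where
  zero : ∀ x, π 0 x = x
  nested : ∀ k, ∀ x ∈ E, ∃ y ∈ E, π (k + 1) x = π k y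
  dist_succ_le : ∀ k, ∀ x ∈ E, dist (π k x) (π (k + 1) x) ≤ 2 ^ (k + 1) * s
  factor : ∀ k, ∀ x ∈ E, ∀ y ∈ E, π k x = π k y → π (k + 1) x = π (k + 1) y
  separated : ∀ k, ∀ x ∈ E, ∀ y ∈ E, π k x ≠ π k y → 2 ^ k * s < dist (π k x) (π k y)

lemma exists_isNetHierarchy {α : Type*} [MetricSpace α] (E : Finset α) {s : ℝ} (hs : 0 < s)
    (hE : ∀ x ∈ E, ∀ y ∈ E, x ≠ y → s < dist x y) : ∃ π, IsNetHierarchy E s π := by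
  classical
  have hpos : ∀ k : ℕ, 0 ≤ 2 ^ (k + 1) * s := fun k => by positivity
  choose F hF hFsep using fun (k : ℕ) (X : Finset α) => exists_net_projection (hpos k) X
  let π : ℕ → α → α := fun k => Nat.rec id (fun k p => F k (E.image p) ∘ p) k
  have hsucc : ∀ k x, π (k + 1) x = F k (E.image (π k)) (π k x) := fun _ _ => rfl
  have hmem : ∀ k, ∀ x ∈ E, π k x ∈ E.image (π k) := fun k x hx => Finset.mem_image_of_mem _ hx
  refine ⟨π, fun _ => rfl, ?_, ?_, ?_, ?_⟩
  · intro k x hx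
    obtain ⟨y, hy, h⟩ := Finset.mem_image.1 (hF k _ _ (hmem k x hx)).1
    exact ⟨y, hy, by rw [hsucc, h]⟩
  · intro k x hx
    rw [hsucc]
    exact (hF k _ _ (hmem k x hx)).2
  · intro k x _ y _ h
    rw [hsucc, hsucc, h]
  · intro k x hx y hy h
    cases k with
    | zero => simpa [π] using hE x hx y hy h
    | succ k =>
      rw [hsucc, hsucc] at h ⊢
      exact hFsep k _ _ (hmem k x hx) _ (hmem k y hy) h

namespace IsNetHierarchy

variable {α : Type*} [MetricSpace α] {E : Finset α} {s : ℝ} {π : ℕ → α → α}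

lemma exists_eq_of_le (h : IsNetHierarchy E s π) {j k : ℕ} (hjk : j ≤ k) :
    ∀ x ∈ E, ∃ y ∈ E, π k x = π j y := by
  induction k, hjk using Nat.le_induction with
  | base => exact fun x hx => ⟨x, hx, rfl⟩
  | succ k _ ih =>
    intro x hx
    obtain ⟨y, hy, hxy⟩ := h.nested k x hx
    obtain ⟨z, hz, hyz⟩ := ih y hy
    exact ⟨z, hz, hxy.trans hyz⟩

lemma mem (h : IsNetHierarchy E s π) (k : ℕ) {x : α} (hx : x ∈ E) : π k x ∈ E := by
  obtain ⟨y, hy, hxy⟩ := h.exists_eq_of_le (Nat.zero_le k) x hx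
  rwa [hxy, h.zero]

lemma dist_le (h : IsNetHierarchy E s π) (hs : 0 < s) (k : ℕ) {x : α} (hx : x ∈ E) :
    dist x (π k x) ≤ 2 * (2 ^ k * s) := by
  induction k with
  | zero => rw [h.zero, dist_self]; positivity
  | succ k ih =>
    have h1 := h.dist_succ_le k x hx
    have h2 := dist_triangle x (π k x) (π (k + 1) x)
    rw [pow_succ] at h1 ⊢
    linarith

/-- If the ancestors of two points are far apart at some level, so are those one level below. -/
lemma far_of_far_succ (h : IsNetHierarchy E s π) (hs : 0 < s) {Λ : ℝ} (hΛ : 4 ≤ Λ) {k : ℕ}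
    {x y : α} (hx : x ∈ E) (hy : y ∈ E)
    (hfar : Λ * (2 ^ (k + 1) * s) ≤ dist (π (k + 1) x) (π (k + 1) y)) :
    Λ * (2 ^ k * s) ≤ dist (π k x) (π k y) := by
  have h1 := h.dist_succ_le k x hx
  have h2 := h.dist_succ_le k y hy
  have h4 : 0 < 2 ^ k * s := by positivity
  have h3 := dist_triangle4_right (π (k + 1) x) (π (k + 1) y) (π k x) (π k y)
  rw [dist_comm (π (k + 1) x) (π k x), dist_comm (π (k + 1) y) (π k y)] at h3
  rw [pow_succ] at h1 h2 hfar
  nlinarith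

lemma far_of_far_of_le (h : IsNetHierarchy E s π) (hs : 0 < s) {Λ : ℝ} (hΛ : 4 ≤ Λ) {j k : ℕ}
    (hjk : j ≤ k) {x y : α} (hx : x ∈ E) (hy : y ∈ E)
    (hfar : Λ * (2 ^ k * s) ≤ dist (π k x) (π k y)) :
    Λ * (2 ^ j * s) ≤ dist (π j x) (π j y) := by
  induction k, hjk using Nat.le_induction with
  | base => exact hfar
  | succ k _ ih => exact ih (h.far_of_far_succ hs hΛ hx hy hfar)

/-- The last level at which the ancestors of two distinct points are far apart. -/
lemma exists_level (h : IsNetHierarchy E s π) (hs : 0 < s) {Λ : ℝ} (hΛ : 4 < Λ)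
    (hE : ∀ x ∈ E, ∀ y ∈ E, x ≠ y → Λ * s ≤ dist x y) {x y : α} (hx : x ∈ E) (hy : y ∈ E)
    (hxy : x ≠ y) :
    ∃ k, Λ * (2 ^ k * s) ≤ dist (π k x) (π k y) ∧
      dist (π (k + 1) x) (π (k + 1) y) < Λ * (2 ^ (k + 1) * s) := by
  by_contra! hcon
  have hall : ∀ k, Λ * (2 ^ k * s) ≤ dist (π k x) (π k y) := by
    intro k
    induction k with
    | zero => simpa [h.zero] using hE x hx y hy hxy
    | succ k ih => exact hcon k ih
  obtain ⟨k, hk⟩ := pow_unbounded_of_one_lt (dist x y / ((Λ - 4) * s)) (one_lt_two (α := ℝ))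
  have hpos : 0 < (Λ - 4) * s := mul_pos (by linarith) hs
  rw [div_lt_iff₀ hpos] at hk
  have h1 := hall k
  have h2 := h.dist_le hs k hx
  have h3 := h.dist_le hs k hy
  have h4 := dist_triangle4_right (π k x) (π k y) x y
  rw [dist_comm (π k x) x, dist_comm (π k y) y] at h4
  nlinarith

end IsNetHierarchy

/-- Packing: a separated set in a ball has boundedly many points. -/
lemma exists_card_le_of_separated (V : Type*) [NormedAddCommGroup V] [NormedSpace ℝ V]
    [FiniteDimensional ℝ V] (R : ℝ) :
    ∃ P : ℕ, ∀ (c : V) (r : ℝ), 0 < r → ∀ S : Finset V, (∀ v ∈ S, dist c v ≤ R * r) →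
      (∀ v ∈ S, ∀ w ∈ S, v ≠ w → r < dist v w) → S.card ≤ P := by
  have : ProperSpace V := FiniteDimensional.proper ℝ V
  obtain ⟨t, ht, hcov⟩ := Metric.totallyBounded_iff.1
    (isCompact_closedBall (0 : V) R).totallyBounded (1 / 2) (by norm_num)
  refine ⟨ht.toFinset.card, fun c r hr S hS hsep => ?_⟩
  have hnear : ∀ v ∈ S, ∃ p ∈ t, dist (r⁻¹ • (v - c)) p < 1 / 2 := by
    intro v hv
    have hmem : r⁻¹ • (v - c) ∈ Metric.closedBall (0 : V) R := by
      rw [mem_closedBall_zero_iff, norm_smul, norm_inv, Real.norm_of_nonneg hr.le,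
        ← dist_eq_norm, dist_comm, inv_mul_le_iff₀ hr, mul_comm]
      exact hS v hv
    simpa using hcov hmem
  choose! p hpt hp using hnear
  refine Finset.card_le_card_of_injOn p (fun v hv => by simpa using hpt v hv) ?_
  intro v hv w hw hvw
  by_contra hne
  have h1 := hp v hv
  have h2 := hp w hw
  rw [← hvw] at h2
  have h3 := dist_triangle_right (r⁻¹ • (v - c)) (r⁻¹ • (w - c)) (p v)
  have h4 : dist (r⁻¹ • (v - c)) (r⁻¹ • (w - c)) = r⁻¹ * dist v w := by
    rw [dist_smul₀, dist_sub_right, norm_inv, Real.norm_of_nonneg hr.le]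
  have h5 : r⁻¹ * dist v w < 1 := by linarith
  rw [inv_mul_lt_iff₀ hr, mul_one] at h5
  exact absurd (hsep v hv w hw hne) (not_lt.2 h5.le)

/-- Few levels and pairs of close net points `(u, v)` are such that `u` leaves the net
within `m` levels. -/
lemma IsNetHierarchy.card_le {α : Type*} [MetricSpace α] {E : Finset α} {s : ℝ}
    {π : ℕ → α → α} (h : IsNetHierarchy E s π) (hs : 0 < s) {R : ℝ} {m P : ℕ}
    (hP : ∀ (c : α) (r : ℝ), 0 < r → ∀ S : Finset α, (∀ v ∈ S, dist c v ≤ R * r) →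
      (∀ v ∈ S, ∀ w ∈ S, v ≠ w → r < dist v w) → S.card ≤ P)
    (I : Finset (ℕ × α × α))
    (hI : ∀ k u v, (k, u, v) ∈ I → (∃ x ∈ E, π k x = u) ∧ (∃ y ∈ E, π k y = v) ∧
      dist u v ≤ R * (2 ^ k * s) ∧ ∀ x ∈ E, π (k + m) x ≠ u) :
    I.card ≤ m * P * E.card := by
  classical
  have hfib : ∀ q ∈ I.image (fun t => (t.2.1, t.1)),
      (I.filter fun t => (t.2.1, t.1) = q).card ≤ P := by
    rintro ⟨u, k⟩ -
    have hinj : Set.InjOn (fun t : ℕ × α × α => t.2.2)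
        (I.filter fun t => (t.2.1, t.1) = (u, k)) := by
      rintro ⟨k₁, u₁, v₁⟩ h₁ ⟨k₂, u₂, v₂⟩ h₂ hv
      simp only [Finset.coe_filter, Set.mem_ofPred_eq, Prod.mk.injEq] at h₁ h₂ hv ⊢
      exact ⟨h₁.2.2.trans h₂.2.2.symm, h₁.2.1.trans h₂.2.1.symm, hv⟩
    rw [← Finset.card_image_of_injOn hinj]
    refine hP u (2 ^ k * s) (by positivity) _ ?_ ?_
    · intro v hv
      simp only [Finset.mem_image, Finset.mem_filter, Prod.exists, Prod.mk.injEq] at hv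
      obtain ⟨_, _, _, ⟨ht, rfl, rfl⟩, rfl⟩ := hv
      exact (hI _ _ _ ht).2.2.1
    · intro v hv w hw hne
      simp only [Finset.mem_image, Finset.mem_filter, Prod.exists, Prod.mk.injEq] at hv hw
      obtain ⟨_, _, _, ⟨ht, rfl, rfl⟩, rfl⟩ := hv
      obtain ⟨_, _, _, ⟨ht', rfl, rfl⟩, rfl⟩ := hw
      obtain ⟨x, hx, rfl⟩ := (hI _ _ _ ht).2.1
      obtain ⟨y, hy, rfl⟩ := (hI _ _ _ ht').2.1
      exact h.separated _ x hx y hy hne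
  have hlev : ∀ u ∈ (I.image (fun t => (t.2.1, t.1))).image Prod.fst,
      ((I.image (fun t => (t.2.1, t.1))).filter fun q => q.1 = u).card ≤ m := by
    intro u _
    let T := sInf {j | ∀ x ∈ E, π j x ≠ u}
    have hsub : ((I.image (fun t => (t.2.1, t.1))).filter fun q => q.1 = u) ⊆
        (Finset.Ico (T - m) T).image (fun k => (u, k)) := by
      rintro ⟨u', k⟩ hq
      obtain ⟨hq, hu⟩ := Finset.mem_filter.1 hq
      obtain ⟨⟨k', u₁, v⟩, ht, heq⟩ := Finset.mem_image.1 hq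
      obtain ⟨rfl, rfl⟩ : u₁ = u' ∧ k' = k := by simpa using heq
      obtain rfl : u₁ = u := hu
      obtain ⟨⟨x, hx, hxu⟩, _, _, hm⟩ := hI _ _ _ ht
      have hmem : k' + m ∈ {j | ∀ x ∈ E, π j x ≠ u₁} := hm
      have hle : T ≤ k' + m := Nat.sInf_le hmem
      have hT : ∀ x ∈ E, π T x ≠ u₁ := Nat.sInf_mem ⟨_, hmem⟩
      have hlt : k' < T := lt_of_not_ge fun hge => by
        obtain ⟨y, hy, hxy⟩ := h.exists_eq_of_le hge x hx
        exact hT y hy (hxy.symm.trans hxu)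
      refine Finset.mem_image.2 ⟨k', Finset.mem_Ico.2 ⟨?_, hlt⟩, rfl⟩
      omega
    refine (Finset.card_le_card hsub).trans (Finset.card_image_le.trans ?_)
    rw [Nat.card_Ico]
    omega
  have hE : (I.image (fun t => (t.2.1, t.1))).image Prod.fst ⊆ E := by
    intro u hu
    simp only [Finset.mem_image, Prod.exists, Prod.mk.injEq] at hu
    obtain ⟨_, _, ⟨_, _, _, ht, rfl, rfl⟩, rfl⟩ := hu
    obtain ⟨x, hx, rfl⟩ := (hI _ _ _ ht).1
    exact h.mem _ hx
  calc I.card ≤ P * (I.image (fun t => (t.2.1, t.1))).card :=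
        Finset.card_le_mul_card_image I P hfib
    _ ≤ P * (m * ((I.image (fun t => (t.2.1, t.1))).image Prod.fst).card) :=
        Nat.mul_le_mul_left _ (Finset.card_le_mul_card_image _ m hlev)
    _ ≤ P * (m * E.card) := by gcongr
    _ = m * P * E.card := by ring

/-- There are linearly many levels and pairs of distinct close net points. -/
lemma IsNetHierarchy.card_le_of_close {α : Type*} [MetricSpace α] {E : Finset α} {s : ℝ}
    {π : ℕ → α → α} (h : IsNetHierarchy E s π) (hs : 0 < s) {R : ℝ} {m P : ℕ}
    (hm : R ≤ 2 ^ m)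
    (hP : ∀ (c : α) (r : ℝ), 0 < r → ∀ S : Finset α, (∀ v ∈ S, dist c v ≤ R * r) →
      (∀ v ∈ S, ∀ w ∈ S, v ≠ w → r < dist v w) → S.card ≤ P)
    (I : Finset (ℕ × α × α))
    (hI : ∀ k u v, (k, u, v) ∈ I → (∃ x ∈ E, π k x = u) ∧ (∃ y ∈ E, π k y = v) ∧
      dist u v ≤ R * (2 ^ k * s) ∧ u ≠ v) :
    I.card ≤ 2 * (m * P) * E.card := by
  classical
  let I₁ := I.filter fun t => t.2.1 ∉ E.image (π (t.1 + m))
  let I₂ := I.filter fun t => t.2.2 ∉ E.image (π (t.1 + m))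
  have h₁ : I₁.card ≤ m * P * E.card := by
    refine h.card_le hs hP I₁ fun k u v ht => ?_
    obtain ⟨ht, hmu⟩ := Finset.mem_filter.1 ht
    obtain ⟨hu, hv, hd, _⟩ := hI _ _ _ ht
    exact ⟨hu, hv, hd, fun x hx hxu => hmu (Finset.mem_image.2 ⟨x, hx, hxu⟩)⟩
  have h₂ : (I₂.image fun t => (t.1, t.2.2, t.2.1)).card ≤ m * P * E.card := by
    refine h.card_le hs hP _ fun k u v ht => ?_
    obtain ⟨⟨k', u', v'⟩, ht', heq⟩ := Finset.mem_image.1 ht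
    obtain ⟨rfl, rfl, rfl⟩ : k' = k ∧ v' = u ∧ u' = v := by simpa using heq
    obtain ⟨ht, hmu⟩ := Finset.mem_filter.1 ht'
    obtain ⟨hu, hv, hd, _⟩ := hI _ _ _ ht
    exact ⟨hv, hu, dist_comm u' v' ▸ hd,
      fun x hx hxu => hmu (Finset.mem_image.2 ⟨x, hx, hxu⟩)⟩
  have hinj : Function.Injective fun t : ℕ × α × α => (t.1, t.2.2, t.2.1) := by
    rintro ⟨_, _, _⟩ ⟨_, _, _⟩ h
    simp_all
  rw [Finset.card_image_of_injective _ hinj] at h₂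
  have hsub : I ⊆ I₁ ∪ I₂ := by
    rintro ⟨k, u, v⟩ ht
    obtain ⟨_, _, hd, hne⟩ := hI _ _ _ ht
    by_contra hcon
    simp only [I₁, I₂, Finset.mem_union, Finset.mem_filter, ht, true_and, not_or, not_not] at hcon
    obtain ⟨hu, hv⟩ := hcon
    obtain ⟨x, hx, rfl⟩ := Finset.mem_image.1 hu
    obtain ⟨y, hy, rfl⟩ := Finset.mem_image.1 hv
    have h1 := h.separated (k + m) x hx y hy hne
    have h2 : R * (2 ^ k * s) ≤ 2 ^ m * (2 ^ k * s) :=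
      mul_le_mul_of_nonneg_right hm (by positivity)
    have h3 : (2 : ℝ) ^ (k + m) * s = 2 ^ m * (2 ^ k * s) := by ring
    linarith
  have := (Finset.card_le_card hsub).trans (Finset.card_union_le _ _)
  linarith

/-- Well-separated pair decomposition of a finite subset of a metric space in which separated
subsets of balls have boundedly many points. -/
theorem exists_wellSeparated_decomposition {α : Type*} [MetricSpace α] {κ : ℝ} (hκ : 0 < κ)
    {m P : ℕ} (hm : 2 * (4 + 4 / κ) + 4 ≤ (2 : ℝ) ^ m)
    (hP : ∀ (c : α) (r : ℝ), 0 < r → ∀ S : Finset α,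
      (∀ v ∈ S, dist c v ≤ (2 * (4 + 4 / κ) + 4) * r) →
      (∀ v ∈ S, ∀ w ∈ S, v ≠ w → r < dist v w) → S.card ≤ P)
    (E : Finset α) :
    ∃ (L : ℕ) (E' E'' : Fin L → Set α),
      (∀ ℓ, (E' ℓ).Nonempty ∧ (E'' ℓ).Nonempty) ∧
      (∀ ℓ₁ ℓ₂, ℓ₁ ≠ ℓ₂ →
        Disjoint ((E' ℓ₁) ×ˢ (E'' ℓ₁)) ((E' ℓ₂) ×ˢ (E'' ℓ₂))) ∧
      (⋃ ℓ, (E' ℓ) ×ˢ (E'' ℓ)) = ((E : Set α) ×ˢ (E : Set α)) \ {p : α × α | p.1 = p.2} ∧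
      L ≤ 2 * (m * P) * E.card ∧
      (∀ ℓ, Metric.diam (E' ℓ) ≤ κ * setDist (E' ℓ) (E'' ℓ) ∧
        Metric.diam (E'' ℓ) ≤ κ * setDist (E' ℓ) (E'' ℓ)) := by
  classical
  obtain ⟨Λ, hΛ⟩ : ∃ Λ, Λ = 4 + 4 / κ := ⟨_, rfl⟩
  rw [← hΛ] at hm hP
  have hκΛ : κ * (Λ - 4) = 4 := by rw [hΛ]; field_simp; ring
  replace hΛ : 4 < Λ := by
    have : 0 < 4 / κ := by positivity
    linarith
  obtain ⟨s, hs, hE⟩ : ∃ s : ℝ, 0 < s ∧ ∀ x ∈ E, ∀ y ∈ E, x ≠ y → Λ * s ≤ dist x y := by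
    obtain ⟨δ, hδ, h⟩ : ∃ δ : ℝ, 0 < δ ∧ ∀ p ∈ E.offDiag, δ ≤ dist p.1 p.2 := by
      rcases E.offDiag.eq_empty_or_nonempty with h | h
      · exact ⟨1, one_pos, by simp [h]⟩
      · obtain ⟨p, hp, hmin⟩ := E.offDiag.exists_min_image (fun p => dist p.1 p.2) h
        exact ⟨dist p.1 p.2, dist_pos.2 (Finset.mem_offDiag.1 hp).2.2, hmin⟩
    refine ⟨δ / Λ, div_pos hδ (by linarith), fun x hx y hy hxy => ?_⟩
    rw [mul_div_cancel₀ _ (by linarith)]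
    exact h (x, y) (Finset.mem_offDiag.2 ⟨hx, hy, hxy⟩)
  obtain ⟨π, hπ⟩ := exists_isNetHierarchy E hs fun x hx y hy hxy =>
    lt_of_lt_of_le (by nlinarith) (hE x hx y hy hxy)
  let IsLevel (x y : α) (k : ℕ) : Prop := Λ * (2 ^ k * s) ≤ dist (π k x) (π k y) ∧
    dist (π (k + 1) x) (π (k + 1) y) < Λ * (2 ^ (k + 1) * s)
  have hex : ∀ p : α × α, ∃ k, p ∈ E.offDiag → IsLevel p.1 p.2 k := by
    intro p
    by_cases hp : p ∈ E.offDiag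
    · obtain ⟨hx, hy, hxy⟩ := Finset.mem_offDiag.1 hp
      obtain ⟨k, hk⟩ := hπ.exists_level hs hΛ hE hx hy hxy
      exact ⟨k, fun _ => hk⟩
    · exact ⟨0, fun h => absurd h hp⟩
  choose lev hlev using hex
  have huniq : ∀ x ∈ E, ∀ y ∈ E, ∀ j k, IsLevel x y j → IsLevel x y k → j ≤ k := by
    intro x hx y hy j k hj hk
    by_contra! hlt
    exact absurd (hπ.far_of_far_of_le hs hΛ.le hlt hx hy hj.1) (not_le.2 hk.2)
  let I : Finset (ℕ × α × α) :=
    E.offDiag.image fun p => (lev p, π (lev p) p.1, π (lev p) p.2)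
  have hI : ∀ t ∈ I, ∃ x ∈ E, ∃ y ∈ E, IsLevel x y t.1 ∧ π t.1 x = t.2.1 ∧ π t.1 y = t.2.2 := by
    intro t ht
    obtain ⟨p, hp, rfl⟩ := Finset.mem_image.1 ht
    obtain ⟨hx, hy, _⟩ := Finset.mem_offDiag.1 hp
    exact ⟨p.1, hx, p.2, hy, hlev p hp, rfl, rfl⟩
  have hlevel : ∀ t ∈ I, ∀ x ∈ E, ∀ y ∈ E, π t.1 x = t.2.1 → π t.1 y = t.2.2 →
      IsLevel x y t.1 := by
    intro t ht x hx y hy hxt hyt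
    obtain ⟨x₀, hx₀, y₀, hy₀, hl, hx₀t, hy₀t⟩ := hI t ht
    have ex := hxt.trans hx₀t.symm
    have ey := hyt.trans hy₀t.symm
    have ex' := hπ.factor _ x hx x₀ hx₀ ex
    have ey' := hπ.factor _ y hy y₀ hy₀ ey
    simp only [IsLevel] at hl ⊢
    rwa [ex, ey, ex', ey']
  have hclose : ∀ t ∈ I, dist t.2.1 t.2.2 ≤ (2 * Λ + 4) * (2 ^ t.1 * s) := by
    intro t ht
    obtain ⟨x, hx, y, hy, hl, hxt, hyt⟩ := hI t ht
    have h1 := hπ.dist_succ_le t.1 x hx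
    have h2 := hπ.dist_succ_le t.1 y hy
    have h3 := dist_triangle4_right (π t.1 x) (π t.1 y) (π (t.1 + 1) x) (π (t.1 + 1) y)
    have h4 := hl.2
    rw [pow_succ] at h1 h2 h4
    rw [← hxt, ← hyt]
    nlinarith
  have hne : ∀ t ∈ I, t.2.1 ≠ t.2.2 := by
    intro t ht h
    obtain ⟨x, hx, y, hy, hl, hxt, hyt⟩ := hI t ht
    have h1 := hl.1
    rw [hxt, hyt, h, dist_self] at h1
    have : 0 < Λ * (2 ^ t.1 * s) := mul_pos (by linarith) (by positivity)
    linarith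
  have hcard : I.card ≤ 2 * (m * P) * E.card := by
    refine hπ.card_le_of_close hs hm hP I fun k u v ht => ?_
    obtain ⟨x, hx, y, hy, _, hxt, hyt⟩ := hI _ ht
    exact ⟨⟨x, hx, hxt⟩, ⟨y, hy, hyt⟩, hclose _ ht, hne _ ht⟩
  let e := I.equivFin.symm
  refine ⟨I.card, fun ℓ => {x | x ∈ E ∧ π (e ℓ).1.1 x = (e ℓ).1.2.1},
    fun ℓ => {y | y ∈ E ∧ π (e ℓ).1.1 y = (e ℓ).1.2.2}, ?_, ?_, ?_, hcard, ?_⟩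
  · intro ℓ
    obtain ⟨x, hx, y, hy, _, hxt, hyt⟩ := hI _ (e ℓ).2
    exact ⟨⟨x, hx, hxt⟩, ⟨y, hy, hyt⟩⟩
  · intro ℓ₁ ℓ₂ hℓ
    rw [Set.disjoint_left]
    rintro ⟨x, y⟩ ⟨⟨hx, hx₁⟩, ⟨hy, hy₁⟩⟩ ⟨⟨_, hx₂⟩, ⟨_, hy₂⟩⟩
    have l₁ := hlevel _ (e ℓ₁).2 x hx y hy hx₁ hy₁
    have l₂ := hlevel _ (e ℓ₂).2 x hx y hy hx₂ hy₂
    have hk := le_antisymm (huniq x hx y hy _ _ l₁ l₂) (huniq x hx y hy _ _ l₂ l₁)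
    refine hℓ (e.injective (Subtype.ext (Prod.ext hk (Prod.ext ?_ ?_))))
    · rw [← hx₁, ← hx₂, hk]
    · rw [← hy₁, ← hy₂, hk]
  · ext ⟨x, y⟩
    simp only [Set.mem_iUnion, Set.mem_prod, Set.mem_ofPred_eq, Set.mem_sdiff, Finset.mem_coe]
    constructor
    · rintro ⟨ℓ, ⟨hx, hxt⟩, ⟨hy, hyt⟩⟩
      refine ⟨⟨hx, hy⟩, ?_⟩
      rintro rfl
      exact hne _ (e ℓ).2 (hxt.symm.trans hyt)
    · rintro ⟨⟨hx, hy⟩, hxy⟩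
      have hp : (x, y) ∈ E.offDiag := Finset.mem_offDiag.2 ⟨hx, hy, hxy⟩
      refine ⟨e.symm ⟨_, Finset.mem_image_of_mem _ hp⟩, ?_⟩
      simp [hx, hy]
  · intro ℓ
    obtain ⟨x₀, hx₀, y₀, hy₀, _, hx₀t, hy₀t⟩ := hI _ (e ℓ).2
    have hdist : (Λ - 4) * (2 ^ (e ℓ).1.1 * s) ≤
        setDist {x | x ∈ E ∧ π (e ℓ).1.1 x = (e ℓ).1.2.1}
          {y | y ∈ E ∧ π (e ℓ).1.1 y = (e ℓ).1.2.2} := by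
      refine le_csInf ⟨_, x₀, ⟨hx₀, hx₀t⟩, y₀, ⟨hy₀, hy₀t⟩, rfl⟩ ?_
      rintro _ ⟨x, ⟨hx, hxt⟩, y, ⟨hy, hyt⟩, rfl⟩
      have h1 := (hlevel _ (e ℓ).2 x hx y hy hxt hyt).1
      have h2 := hπ.dist_le hs (e ℓ).1.1 hx
      have h3 := hπ.dist_le hs (e ℓ).1.1 hy
      have h4 := dist_triangle4_right (π (e ℓ).1.1 x) (π (e ℓ).1.1 y) x y
      rw [dist_comm _ x, dist_comm _ y] at h4
      linarith
    have hdiam : ∀ c : α,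
        Metric.diam {x | x ∈ E ∧ π (e ℓ).1.1 x = c} ≤ 4 * (2 ^ (e ℓ).1.1 * s) := by
      intro c
      refine Metric.diam_le_of_forall_dist_le (by positivity) ?_
      rintro x ⟨hx, hxt⟩ y ⟨hy, hyt⟩
      have h2 := hπ.dist_le hs (e ℓ).1.1 hx
      have h3 := hπ.dist_le hs (e ℓ).1.1 hy
      have h4 := dist_triangle_right x y c
      rw [hxt] at h2
      rw [hyt] at h3
      linarith
    have hle := mul_le_mul_of_nonneg_left hdist hκ.le
    rw [← mul_assoc, hκΛ] at hle
    exact ⟨(hdiam _).trans hle, (hdiam _).trans hle⟩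

/-- Callahan–Kosaraju decomposition: `E × E` minus its
diagonal can be partitioned into at most `C(κ,n)·N` well-separated products. -/
theorem statement11 :
    ∀ κ : ℝ, 0 < κ → ∀ n : ℕ, 1 ≤ n → ∃ C : ℕ,
      ∀ E : Set (En n), E.Finite → 2 ≤ E.ncard →
        ∃ (L : ℕ) (E' E'' : Fin L → Set (En n)),
          (∀ ℓ, (E' ℓ).Nonempty ∧ (E'' ℓ).Nonempty) ∧
          (∀ ℓ₁ ℓ₂, ℓ₁ ≠ ℓ₂ →
            Disjoint ((E' ℓ₁) ×ˢ (E'' ℓ₁)) ((E' ℓ₂) ×ˢ (E'' ℓ₂))) ∧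
          (⋃ ℓ, (E' ℓ) ×ˢ (E'' ℓ)) = (E ×ˢ E) \ {p : En n × En n | p.1 = p.2} ∧
          L ≤ C * E.ncard ∧
          (∀ ℓ, Metric.diam (E' ℓ) ≤ κ * setDist (E' ℓ) (E'' ℓ) ∧
            Metric.diam (E'' ℓ) ≤ κ * setDist (E' ℓ) (E'' ℓ)) := by
  intro κ hκ n _
  obtain ⟨m, hm⟩ := pow_unbounded_of_one_lt (2 * (4 + 4 / κ) + 4) (one_lt_two (α := ℝ))
  obtain ⟨P, hP⟩ := exists_card_le_of_separated (En n) (2 * (4 + 4 / κ) + 4)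
  refine ⟨2 * (m * P), fun E₀ hfin _ => ?_⟩
  lift E₀ to Finset (En n) using hfin with E
  rw [Set.ncard_coe_finset]
  exact exists_wellSeparated_decomposition hκ hm.le hP E
end

section
/- There exist universal constants κ₀ > 0 and C such that the following holds. Let E ⊂ ℝ² be finite with #E ≥ 2, let f : E → [0,∞), and let M ≥ 0. Suppose E × E minus its diagonal is partitioned into sets E′₁ × E″₁, …, E′_L × E″_L with diam(E′_ℓ) ≤ κ₀·dist(E′_ℓ, E″_ℓ) and diam(E″_ℓ) ≤ κ₀·dist(E′_ℓ, E″_ℓ) for each ℓ, and pick x′_ℓ ∈ E′_ℓ, x″_ℓ ∈ E″_ℓ. Suppose P⃗ = (P^x)_{x∈E} ∈ W²₊(E) satisfies: (A) for each x ∈ E there exists F_x ∈ C²(ℝ²) with F_x ≥ 0 on ℝ², ‖F_x‖_{C²(ℝ²)} ≤ M, and J_x F_x = P^x; and (B) |∂^α(P^{x′_ℓ} − P^{x″_ℓ})(x″_ℓ)| ≤ M·|x′_ℓ − x″_ℓ|^{2−|α|} for all |α| ≤ 1 and ℓ = 1, …, L. Then ‖P⃗‖_{W²₊(E)} ≤ C·M.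 -/
open scoped Classical

/-- Moving the base point at which the difference of two affine polynomials is evaluated. -/
theorem abs_evalA_sub_le (P Q : AffPoly) (x y : E2) :
    |evalA P y - evalA Q y| ≤ |evalA P x - evalA Q x| + ‖P.2 - Q.2‖ * dist y x := by
  have h : evalA P y - evalA Q y = (evalA P x - evalA Q x) + (P.2 - Q.2) (y - x) := by
    simp only [evalA, map_sub, sub_apply]
    ring
  rw [h, dist_eq_norm]
  exact (abs_add_le _ _).trans (add_le_add_right ((P.2 - Q.2).le_opNorm (y - x)) _)

/-- First-order Taylor estimate for a function whose second derivative is bounded by `M`. -/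
theorem abs_sub_evalA_le {F : E2 → ℝ} {M : ℝ} (hF : ContDiff ℝ 2 F)
    (hM : ∀ z, ‖iteratedFDeriv ℝ 2 F z‖ ≤ M) {P : AffPoly} {x : E2}
    (h0 : F x = evalA P x) (h1 : fderiv ℝ F x = P.2) (y : E2) :
    |F y - evalA P y| ≤ M * dist y x ^ 2 := by
  have hdF : Differentiable ℝ F := hF.differentiable (by norm_num)
  have hd2 : Differentiable ℝ (fderiv ℝ F) :=
    (hF.fderiv_right (m := 1) (by norm_num)).differentiable (by norm_num)
  have hM2 (z : E2) : ‖fderiv ℝ (fderiv ℝ F) z‖ ≤ M := by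
    rw [← norm_iteratedFDeriv_one, norm_iteratedFDeriv_fderiv]
    exact hM z
  have hM0 : 0 ≤ M := (norm_nonneg _).trans (hM x)
  have hgrad (z : E2) : ‖fderiv ℝ F z - P.2‖ ≤ M * ‖z - x‖ := by
    rw [← h1]
    exact convex_univ.norm_image_sub_le_of_norm_fderiv_le (fun w _ => hd2 w)
      (fun w _ => hM2 w) (Set.mem_univ x) (Set.mem_univ z)
  have hder (z : E2) : HasFDerivAt (fun w => F w - P.2 w) (fderiv ℝ F z - P.2) z :=
    (hdF z).hasFDerivAt.sub P.2.hasFDerivAt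
  have hmem (z : E2) (hz : z ∈ Metric.closedBall x (dist y x)) :
      ‖fderiv ℝ F z - P.2‖ ≤ M * dist y x := by
    rw [Metric.mem_closedBall, dist_eq_norm] at hz
    exact (hgrad z).trans (mul_le_mul_of_nonneg_left hz hM0)
  have key := (convex_closedBall x (dist y x)).norm_image_sub_le_of_norm_hasFDerivWithin_le
    (fun z _ => (hder z).hasFDerivWithinAt) hmem
    (Metric.mem_closedBall_self dist_nonneg) (Metric.mem_closedBall.2 le_rfl : y ∈ _)
  have he : F y - evalA P y = F y - P.2 y - (F x - P.2 x) := by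
    rw [h0]
    simp only [evalA]
    ring
  rw [he, ← Real.norm_eq_abs]
  refine key.trans_eq ?_
  rw [← dist_eq_norm]
  ring

/-- The quotient measuring the compatibility of a Whitney field at the pair `x`, `y`. -/
noncomputable def whitneyQuotient (P : E2 → AffPoly) (x y : E2) : ℝ :=
  max (|evalA (P x) x - evalA (P y) x| / dist x y ^ 2) (‖(P x).2 - (P y).2‖ / dist x y)

/-- Compatibility of two affine polynomials based at `x` and `y` with constant `K`. -/
def JetClose (K : ℝ) (P : E2 → AffPoly) (x y : E2) : Prop :=
  |evalA (P x) x - evalA (P y) x| ≤ K * dist x y ^ 2 ∧ ‖(P x).2 - (P y).2‖ ≤ K * dist x y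

theorem whitneyQuotient_le_iff {P : E2 → AffPoly} {x y : E2} (h : x ≠ y) {K : ℝ} :
    whitneyQuotient P x y ≤ K ↔ JetClose K P x y := by
  have hd : 0 < dist x y := dist_pos.2 h
  rw [whitneyQuotient, max_le_iff, div_le_iff₀ (by positivity), div_le_iff₀ hd, JetClose]

theorem jetClose_self (K : ℝ) (P : E2 → AffPoly) (x : E2) : JetClose K P x x := by
  simp [JetClose]

/-- Compatibility transfers from a pair `x'`, `x''` to a nearby pair `x`, `y`, with only a
small contribution of the compatibility constant `K` of the short pairs. -/
theorem JetClose.transfer {P : E2 → AffPoly} {K M : ℝ} {x y x' x'' : E2} (hK : 0 ≤ K)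
    (hM : 0 ≤ M) (hx : dist x x' ≤ dist x y / 10) (hy : dist x'' y ≤ dist x y / 10)
    (hxx' : JetClose K P x x') (hx''y : JetClose K P x'' y)
    (h0 : |evalA (P x') x'' - evalA (P x'') x''| ≤ M * dist x' x'' ^ 2)
    (h1 : ‖(P x').2 - (P x'').2‖ ≤ M * dist x' x'') :
    JetClose (K / 4 + 3 * M) P x y := by
  obtain ⟨a0, a1⟩ := hxx'
  obtain ⟨b0, b1⟩ := hx''y
  set d := dist x y with hd
  have hd0 : 0 ≤ d := dist_nonneg
  have hxx'' : dist x x'' ≤ 11 / 10 * d := by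
    have := dist_triangle x y x''
    rw [dist_comm y x''] at this
    linarith
  have hx'x'' : dist x' x'' ≤ 12 / 10 * d := by
    have := dist_triangle x' x x''
    rw [dist_comm x' x] at this
    linarith
  have a0' : |evalA (P x) x - evalA (P x') x| ≤ K * (d / 10) ^ 2 := a0.trans (by gcongr)
  have a1' : ‖(P x).2 - (P x').2‖ ≤ K * (d / 10) := a1.trans (by gcongr)
  have b0' : |evalA (P x'') x'' - evalA (P y) x''| ≤ K * (d / 10) ^ 2 := b0.trans (by gcongr)
  have b1' : ‖(P x'').2 - (P y).2‖ ≤ K * (d / 10) := b1.trans (by gcongr)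
  have h0' : |evalA (P x') x'' - evalA (P x'') x''| ≤ M * (12 / 10 * d) ^ 2 :=
    h0.trans (by gcongr)
  have h1' : ‖(P x').2 - (P x'').2‖ ≤ M * (12 / 10 * d) := h1.trans (by gcongr)
  constructor
  · have e1 : |evalA (P x') x - evalA (P x'') x| ≤
        M * (12 / 10 * d) ^ 2 + M * (12 / 10 * d) * (11 / 10 * d) :=
      (abs_evalA_sub_le _ _ x'' x).trans (by gcongr)
    have e2 : |evalA (P x'') x - evalA (P y) x| ≤
        K * (d / 10) ^ 2 + K * (d / 10) * (11 / 10 * d) :=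
      (abs_evalA_sub_le _ _ x'' x).trans (by gcongr)
    have t1 := abs_sub_le (evalA (P x) x) (evalA (P x') x) (evalA (P y) x)
    have t2 := abs_sub_le (evalA (P x') x) (evalA (P x'') x) (evalA (P y) x)
    have hKd : 0 ≤ K * d ^ 2 := by positivity
    have hMd : 0 ≤ M * d ^ 2 := by positivity
    linarith
  · have t1 := norm_sub_le_norm_sub_add_norm_sub (P x).2 (P x').2 (P y).2
    have t2 := norm_sub_le_norm_sub_add_norm_sub (P x').2 (P x'').2 (P y).2
    have hKd : 0 ≤ K * d := by positivity
    have hMd : 0 ≤ M * d := by positivity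
    linarith

/-- If every pair of distinct points of `E` is close to a pair at which the field is
compatible with constant `M`, then the field is compatible with constant `4 * M`. -/
theorem jetClose_of_forall_exists_near {E : Finset E2} {P : E2 → AffPoly} {M : ℝ} (hM : 0 ≤ M)
    (h : ∀ x ∈ E, ∀ y ∈ E, x ≠ y → ∃ x' ∈ E, ∃ x'' ∈ E,
      dist x x' ≤ dist x y / 10 ∧ dist x'' y ≤ dist x y / 10 ∧
      |evalA (P x') x'' - evalA (P x'') x''| ≤ M * dist x' x'' ^ 2 ∧
      ‖(P x').2 - (P x'').2‖ ≤ M * dist x' x'')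
    {x y : E2} (hx : x ∈ E) (hy : y ∈ E) (hxy : x ≠ y) : JetClose (4 * M) P x y := by
  obtain ⟨⟨u, v⟩, huv, hmax⟩ := E.offDiag.exists_max_image
    (fun p => whitneyQuotient P p.1 p.2) ⟨(x, y), Finset.mem_offDiag.2 ⟨hx, hy, hxy⟩⟩
  obtain ⟨hu, hv, hne⟩ := Finset.mem_offDiag.1 huv
  set K := whitneyQuotient P u v
  have hK : 0 ≤ K := le_max_of_le_left (by positivity)
  have hclose (a : E2) (ha : a ∈ E) (b : E2) (hb : b ∈ E) : JetClose K P a b := by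
    rcases eq_or_ne a b with rfl | hab
    · exact jetClose_self K P a
    · exact (whitneyQuotient_le_iff hab).1 (hmax (a, b) (Finset.mem_offDiag.2 ⟨ha, hb, hab⟩))
  obtain ⟨x', hx', x'', hx'', d1, d2, h0, h1⟩ := h u hu v hv hne
  have hKle : K ≤ K / 4 + 3 * M := (whitneyQuotient_le_iff hne).2
    (JetClose.transfer hK hM d1 d2 (hclose u hu x' hx') (hclose x'' hx'' v hv) h0 h1)
  exact (whitneyQuotient_le_iff hxy).1 <|
    ((whitneyQuotient_le_iff hxy).2 (hclose x hx y hy)).trans (by linarith)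

theorem setDist_le_dist {α : Type*} [PseudoMetricSpace α] {X Y : Set α} {x y : α}
    (hx : x ∈ X) (hy : y ∈ Y) : setDist X Y ≤ dist x y :=
  csInf_le ⟨0, by rintro _ ⟨a, _, b, _, rfl⟩; exact dist_nonneg⟩ ⟨x, hx, y, hy, rfl⟩

/-- Sufficient conditions for a Whitney field to have small
`W²₊(E)` norm, given a κ₀-well-separated partition of `E × E` minus its
diagonal. -/
theorem statement12 :
    ∃ κ₀ C : ℝ, 0 < κ₀ ∧ 0 < C ∧
      ∀ (E : Finset E2) (f : E2 → ℝ) (M : ℝ),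
        2 ≤ E.card → (∀ x ∈ E, 0 ≤ f x) → 0 ≤ M →
        ∀ (L : ℕ) (E' E'' : Fin L → Set E2) (x' x'' : Fin L → E2),
          (∀ ℓ₁ ℓ₂, ℓ₁ ≠ ℓ₂ →
            Disjoint ((E' ℓ₁) ×ˢ (E'' ℓ₁)) ((E' ℓ₂) ×ˢ (E'' ℓ₂))) →
          ((⋃ ℓ, (E' ℓ) ×ˢ (E'' ℓ)) =
            ((E : Set E2) ×ˢ (E : Set E2)) \ {p : E2 × E2 | p.1 = p.2}) →
          (∀ ℓ, Metric.diam (E' ℓ) ≤ κ₀ * setDist (E' ℓ) (E'' ℓ) ∧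
            Metric.diam (E'' ℓ) ≤ κ₀ * setDist (E' ℓ) (E'' ℓ)) →
          (∀ ℓ, x' ℓ ∈ E' ℓ ∧ x'' ℓ ∈ E'' ℓ) →
          ∀ P : E2 → AffPoly,
            wPlusMem E P →
            (∀ x ∈ E, ∃ F : E2 → ℝ, ContDiff ℝ 2 F ∧ (∀ y, 0 ≤ F y) ∧
              (∀ z : E2, ∀ i : ℕ, i ≤ 2 → ‖iteratedFDeriv ℝ i F z‖ ≤ M) ∧
              F x = evalA (P x) x ∧ fderiv ℝ F x = (P x).2) →
            (∀ ℓ,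
              |evalA (P (x' ℓ)) (x'' ℓ) - evalA (P (x'' ℓ)) (x'' ℓ)| ≤
                M * dist (x' ℓ) (x'' ℓ) ^ 2 ∧
              ‖(P (x' ℓ)).2 - (P (x'' ℓ)).2‖ ≤ M * dist (x' ℓ) (x'' ℓ)) →
            wPlusNorm E P ≤ C * M := by
  refine ⟨1 / 10, 6, by norm_num, by norm_num, ?_⟩
  intro E _ M _ _ hM L E' E'' x' x'' _ hcover hdiam hmem P _ hA hB
  have hsub (ℓ : Fin L) (a b : E2) (ha : a ∈ E' ℓ) (hb : b ∈ E'' ℓ) : a ∈ E ∧ b ∈ E := by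
    have : (a, b) ∈ ⋃ ℓ, (E' ℓ) ×ˢ (E'' ℓ) := Set.mem_iUnion.2 ⟨ℓ, ha, hb⟩
    rw [hcover] at this
    exact ⟨this.1.1, this.1.2⟩
  have hbd' (ℓ : Fin L) : Bornology.IsBounded (E' ℓ) :=
    E.finite_toSet.isBounded.subset fun a ha => (hsub ℓ a _ ha (hmem ℓ).2).1
  have hbd'' (ℓ : Fin L) : Bornology.IsBounded (E'' ℓ) :=
    E.finite_toSet.isBounded.subset fun b hb => (hsub ℓ _ b (hmem ℓ).1 hb).2
  have hpairs {x y : E2} (hx : x ∈ E) (hy : y ∈ E) (hxy : x ≠ y) : JetClose (4 * M) P x y := by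
    refine jetClose_of_forall_exists_near hM ?_ hx hy hxy
    intro x hx y hy hxy
    have hin : (x, y) ∈ ⋃ ℓ, (E' ℓ) ×ˢ (E'' ℓ) := by
      rw [hcover]
      exact ⟨⟨hx, hy⟩, hxy⟩
    obtain ⟨ℓ, hxℓ, hyℓ⟩ := Set.mem_iUnion.1 hin
    obtain ⟨hx', hx''⟩ := hsub ℓ _ _ (hmem ℓ).1 (hmem ℓ).2
    have hs : setDist (E' ℓ) (E'' ℓ) ≤ dist x y := setDist_le_dist hxℓ hyℓ
    refine ⟨x' ℓ, hx', x'' ℓ, hx'', ?_, ?_, hB ℓ⟩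
    · linarith [Metric.dist_le_diam_of_mem (hbd' ℓ) hxℓ (hmem ℓ).1, (hdiam ℓ).1]
    · linarith [Metric.dist_le_diam_of_mem (hbd'' ℓ) (hmem ℓ).2 hyℓ, (hdiam ℓ).2]
  have hsize : (⨆ x ∈ (E : Set E2), max |evalA (P x) x| ‖(P x).2‖) ≤ M := by
    refine Real.iSup_le (fun x => Real.iSup_le (fun hx => ?_) hM) hM
    obtain ⟨F, _, _, hF, h0, h1⟩ := hA x hx
    refine max_le ?_ ?_
    · simpa [h0] using hF x 0 (by norm_num)
    · simpa [norm_iteratedFDeriv_one, h1] using hF x 1 (by norm_num)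
  have hosc : (⨆ x ∈ (E : Set E2), ⨆ y ∈ (E : Set E2), if x = y then 0 else
      max (|evalA (P x) x - evalA (P y) x| / dist x y ^ 2)
        (‖(P x).2 - (P y).2‖ / dist x y)) ≤ 4 * M := by
    have h4M : 0 ≤ 4 * M := by positivity
    refine Real.iSup_le (fun x => Real.iSup_le (fun hx => Real.iSup_le (fun y =>
      Real.iSup_le (fun hy => ?_) h4M) h4M) h4M) h4M
    split_ifs with hxy
    · exact h4M
    · exact (whitneyQuotient_le_iff hxy).2 (hpairs hx hy hxy)
  have hpos : (⨆ x ∈ (E : Set E2),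
      sInf {M : ℝ | 0 ≤ M ∧ ∀ y : E2, 0 ≤ evalA (P x) y + M * dist y x ^ 2}) ≤ M := by
    refine Real.iSup_le (fun x => Real.iSup_le (fun hx => ?_) hM) hM
    obtain ⟨F, hF2, hF0, hF, h0, h1⟩ := hA x hx
    refine csInf_le ⟨0, fun _ h => h.1⟩ ⟨hM, fun y => ?_⟩
    have := abs_sub_evalA_le hF2 (fun z => hF z 2 le_rfl) h0 h1 y
    linarith [hF0 y, (abs_le.1 this).2]
  rw [wPlusNorm, wNorm]
  linarith
end
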